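/- arXiv:1909.08678 — 5 statements merged into one kernel-verified Lean document; each statement's English description precedes it below -/
import Mathlib

section
/- Let u, B, E ∈ ℝ³ and let S be a symmetric 3×3 real matrix, and assume B × u ≠ 0. Then there exists ξ = (ξ_x, ξ_t) ∈ ℝ³ × ℝ with ξ_x ≠ 0 annihilating the state (u,S,B,E) if and only if S(B×u) + (E·u)u = 0 and B·E = 0. -/
noncomputable section

/-- Vectors in ℝ³. -/
abbrev V3 : Type := Fin 3 → ℝ

/-- Euclidean inner product on ℝ³. -/
def dot3 (a b : V3) : ℝ := ∑ i, a i * b i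

/-- Cross product on ℝ³. -/
def cross3 (a b : V3) : V3 :=
  ![a 1 * b 2 - a 2 * b 1, a 2 * b 0 - a 0 * b 2, a 0 * b 1 - a 1 * b 0]


/-- 3×3 real matrices. -/
abbrev Mat3 : Type := Matrix (Fin 3) (Fin 3) ℝ

/-- A state is a tuple V = (u, S, B, E). -/
abbrev MHDState : Type := V3 × Mat3 × V3 × V3

/-- ξ = (ξ_x, ξ_t) annihilates the state V = (u, S, B, E) if ξ_x·u = 0, ξ_x·B = 0,
ξ_t u + S ξ_x = 0 and ξ_t B + ξ_x × E = 0. -/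
def Annihilates (ξx : V3) (ξt : ℝ) (V : MHDState) : Prop :=
  dot3 ξx V.1 = 0 ∧ dot3 ξx V.2.2.1 = 0 ∧
  ξt • V.1 + V.2.1.mulVec ξx = 0 ∧
  ξt • V.2.2.1 + cross3 ξx V.2.2.2 = 0

theorem dot3_eq (a b : V3) : dot3 a b = a 0 * b 0 + a 1 * b 1 + a 2 * b 2 :=
  Fin.sum_univ_three _

/-- The vector triple product expansion. -/
theorem cross3_cross3 (a b c : V3) :
    cross3 (cross3 a b) c = dot3 a c • b - dot3 b c • a := by
  ext i
  fin_cases i <;> simp [cross3, dot3_eq] <;> ring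

theorem smul_cross3 (r : ℝ) (a b : V3) : cross3 (r • a) b = r • cross3 a b := by
  ext i
  fin_cases i <;> simp [cross3] <;> ring

theorem dot3_cross3_left (a b : V3) : dot3 (cross3 a b) a = 0 := by
  simp [dot3_eq, cross3]
  ring

theorem dot3_cross3_right (a b : V3) : dot3 (cross3 a b) b = 0 := by
  simp [dot3_eq, cross3]
  ring

theorem dot3_comm (a b : V3) : dot3 a b = dot3 b a :=
  dotProduct_comm a b

theorem dot3_self_ne_zero {a : V3} (h : a ≠ 0) : dot3 a a ≠ 0 :=
  fun h' => h (dotProduct_self_eq_zero.mp h')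

theorem cross3_linear_combination_right (r s : ℝ) (a b : V3) :
    cross3 (r • a + s • b) b = r • cross3 a b := by
  ext i
  fin_cases i <;> simp [cross3] <;> ring

theorem cross3_linear_combination_left (r s : ℝ) (a b : V3) :
    cross3 a (r • a + s • b) = s • cross3 a b := by
  ext i
  fin_cases i <;> simp [cross3] <;> ring

/-- Vectors with nonzero cross product are linearly independent. -/
theorem eq_zero_of_smul_add_smul_eq_zero {a b : V3} (h : cross3 a b ≠ 0) {r s : ℝ}
    (hrs : r • a + s • b = 0) : r = 0 ∧ s = 0 := by
  have hr := cross3_linear_combination_right r s a b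
  have hs := cross3_linear_combination_left r s a b
  rw [hrs] at hr hs
  have hl : cross3 0 b = 0 := by simp [cross3]
  have hz : cross3 a 0 = 0 := by simp [cross3]
  rw [hl] at hr
  rw [hz] at hs
  exact ⟨(smul_eq_zero.mp hr.symm).resolve_right h, (smul_eq_zero.mp hs.symm).resolve_right h⟩

/-- A vector orthogonal to `a` and `b` is a multiple of their cross product. -/
theorem exists_eq_smul_cross3 {a b x : V3} (h : cross3 a b ≠ 0)
    (ha : dot3 x a = 0) (hb : dot3 x b = 0) : ∃ r : ℝ, x = r • cross3 a b := by
  have hx : cross3 (cross3 a b) x = 0 := by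
    rw [cross3_cross3, dot3_comm a, dot3_comm b, ha, hb]
    simp
  have key := cross3_cross3 (cross3 a b) x (cross3 a b)
  rw [hx, show cross3 0 (cross3 a b) = 0 by simp [cross3]] at key
  have hne := dot3_self_ne_zero h
  refine ⟨dot3 x (cross3 a b) / dot3 (cross3 a b) (cross3 a b), ?_⟩
  rw [div_eq_inv_mul, mul_smul, ← sub_eq_zero.mp key.symm, inv_smul_smul₀ hne]

/-- Let u, B, E ∈ ℝ³, S a symmetric 3×3 matrix, and assume B × u ≠ 0.  Then there
exists ξ = (ξ_x, ξ_t) with ξ_x ≠ 0 annihilating (u,S,B,E) if and only if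
S(B×u) + (E·u)u = 0 and B·E = 0. -/
theorem stmt1 (u B E : V3) (S : Mat3) (hS : S.IsSymm) (h : cross3 B u ≠ 0) :
    (∃ ξx : V3, ∃ ξt : ℝ, ξx ≠ 0 ∧ Annihilates ξx ξt (u, S, B, E)) ↔
      (S.mulVec (cross3 B u) + dot3 E u • u = 0 ∧ dot3 B E = 0) := by
  constructor
  · rintro ⟨x, t, hx, hu, hB, hSu, hBE⟩
    obtain ⟨r, rfl⟩ := exists_eq_smul_cross3 h hB hu
    have hr : r ≠ 0 := fun hr => hx (by rw [hr, zero_smul])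
    simp only at hSu hBE
    rw [smul_cross3, cross3_cross3] at hBE
    have hcomb : (t - r * dot3 u E) • B + (r * dot3 B E) • u = 0 := by
      rw [← hBE]
      module
    obtain ⟨ht, hE⟩ := eq_zero_of_smul_add_smul_eq_zero h hcomb
    refine ⟨?_, (mul_eq_zero.mp hE).resolve_left hr⟩
    rw [sub_eq_zero.mp ht, Matrix.mulVec_smul, mul_smul, ← smul_add] at hSu
    rw [dot3_comm E u, add_comm]
    exact (smul_eq_zero.mp hSu).resolve_left hr
  · rintro ⟨hSu, hE⟩
    refine ⟨cross3 B u, dot3 E u, h, dot3_cross3_right B u, dot3_cross3_left B u, ?_, ?_⟩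
    · rw [add_comm]
      exact hSu
    · simp only
      rw [cross3_cross3, hE, dot3_comm u E]
      simp
end
end

section
/- Let ω₀ and ω be simple bivectors in Λ²(ℝ⁴) with ω ≠ 0, and let ξ ∈ ℝ⁴ with ξ_x ≠ 0 and ω∧ξ = 0. The following are equivalent: (i) ω₀ + tω is simple for all t ∈ ℝ; (ii) ω₀∧ω = 0; (iii) there exists v ∈ ℝ⁴ with ω = v∧ξ and such that either ω₀ = v₀∧ξ for some v₀ ∈ ℝ⁴, or ω₀ = v∧w₀ for some w₀ ∈ ℝ⁴. -/
noncomputable section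

/-- Vectors in ℝ⁴. -/
abbrev V4 : Type := Fin 4 → ℝ

/-- The exterior algebra of ℝ⁴. -/
abbrev Ext4 : Type := ExteriorAlgebra ℝ V4

/-- The canonical inclusion of ℝ⁴ into its exterior algebra. -/
def ι4 (v : V4) : Ext4 := ExteriorAlgebra.ι ℝ v

/-- The wedge product v∧w of two vectors, as a bivector in Λ²(ℝ⁴). -/
def wedge (v w : V4) : Ext4 := ι4 v * ι4 w

/-- ξ ∈ (ℝ³∖{0})×ℝ: the first three coordinates of ξ are not all zero. -/
def spatialNonzero (ξ : V4) : Prop := ¬(ξ 0 = 0 ∧ ξ 1 = 0 ∧ ξ 2 = 0)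

/-- A bivector ω is simple if ω = v∧w for some v, w ∈ ℝ⁴. -/
def IsSimple (ω : Ext4) : Prop := ∃ v w : V4, ω = wedge v w

/-- The exterior product of a linearly independent family over a field is nonzero. -/
theorem ιMulti_ne_zero_of_linearIndependent {K E : Type*} [Field K] [AddCommGroup E] [Module K E]
    {n : ℕ} {v : Fin n → E} (hv : LinearIndependent K v) : ExteriorAlgebra.ιMulti K n v ≠ 0 := by
  intro h
  obtain ⟨g, hg⟩ := (Fintype.linearCombination K v).exists_leftInverse_of_injective
    (LinearMap.ker_eq_bot.mpr hv.fintypeLinearCombination_injective)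
  let f : E [⋀^Fin n]→ₗ[K] K := (Pi.basisFun K (Fin n)).det.compLinearMap g
  have hgv : g ∘ v = Pi.basisFun K (Fin n) := by
    funext i
    simpa using LinearMap.congr_fun hg (Pi.single i 1)
  have hf : f v = 1 := by
    change (Pi.basisFun K (Fin n)).det (g ∘ v) = 1
    rw [hgv, Module.Basis.det_self]
  have key := ExteriorAlgebra.liftAlternating_apply_ιMulti (R := K)
    (Pi.single (M := fun i => E [⋀^Fin i]→ₗ[K] K) n f) v
  rw [h, map_zero, Pi.single_eq_same, hf] at key
  exact zero_ne_one key

/-- If the exterior product of a family vanishes, the family has a nontrivial linear relation. -/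
theorem exists_relation_of_ιMulti_eq_zero {K E : Type*} [Field K] [AddCommGroup E] [Module K E]
    {n : ℕ} {v : Fin n → E} (h : ExteriorAlgebra.ιMulti K n v = 0) :
    ∃ c : Fin n → K, ∑ i, c i • v i = 0 ∧ ∃ i, c i ≠ 0 :=
  Fintype.not_linearIndependent_iff.mp fun hv => ιMulti_ne_zero_of_linearIndependent hv h

theorem wedge_add_left (a b c : V4) : wedge (a + b) c = wedge a c + wedge b c := by
  simp [wedge, ι4, add_mul]

theorem wedge_add_right (a b c : V4) : wedge a (b + c) = wedge a b + wedge a c := by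
  simp [wedge, ι4, mul_add]

theorem wedge_smul_left (r : ℝ) (a b : V4) : wedge (r • a) b = r • wedge a b := by
  simp [wedge, ι4]

theorem wedge_smul_right (r : ℝ) (a b : V4) : wedge a (r • b) = r • wedge a b := by
  simp [wedge, ι4]

@[simp]
theorem wedge_self (a : V4) : wedge a a = 0 := ExteriorAlgebra.ι_sq_zero a

@[simp]
theorem wedge_zero_left (a : V4) : wedge 0 a = 0 := by simp [wedge, ι4]

theorem wedge_swap (a b : V4) : wedge a b = -wedge b a :=
  eq_neg_of_add_eq_zero_left (ExteriorAlgebra.ι_add_mul_swap a b)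

theorem wedge_neg_left (a b : V4) : wedge (-a) b = -wedge a b := by simp [wedge, ι4]

theorem ι4_mul_wedge (a b c : V4) : ι4 a * wedge b c = wedge b c * ι4 a := by
  have h₁ : ι4 a * ι4 b = -(ι4 b * ι4 a) := wedge_swap a b
  have h₂ : ι4 a * ι4 c = -(ι4 c * ι4 a) := wedge_swap a c
  simp only [wedge]
  rw [← mul_assoc, h₁, neg_mul, mul_assoc, h₂, mul_neg, neg_neg, mul_assoc]

theorem wedge_mul_comm (a b c d : V4) : wedge a b * wedge c d = wedge c d * wedge a b := by
  change ι4 a * ι4 b * wedge c d = wedge c d * (ι4 a * ι4 b)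
  rw [mul_assoc, ι4_mul_wedge, ← mul_assoc, ι4_mul_wedge, mul_assoc]

theorem wedge_mul_wedge_left (a b c : V4) : wedge a b * wedge a c = 0 := by
  rw [show wedge a c = ι4 a * ι4 c from rfl, ← mul_assoc, ← ι4_mul_wedge,
    show wedge a b = ι4 a * ι4 b from rfl, ← mul_assoc,
    show ι4 a * ι4 a = 0 from ExteriorAlgebra.ι_sq_zero a, zero_mul, zero_mul]

/-- Any nontrivial combination of `a` and `b` is a factor of `a ∧ b`. -/
theorem exists_wedge_eq_wedge_combination (a b : V4) {p q : ℝ} (h : ¬(p = 0 ∧ q = 0)) :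
    ∃ w, wedge a b = wedge (p • a + q • b) w := by
  by_cases hp : p = 0
  · have hq : q ≠ 0 := fun hq => h ⟨hp, hq⟩
    refine ⟨(-q⁻¹) • a, ?_⟩
    rw [hp, zero_smul, zero_add, wedge_smul_left, wedge_smul_right, wedge_swap a b, smul_smul]
    simp [hq]
  · refine ⟨p⁻¹ • b, ?_⟩
    rw [wedge_smul_right, wedge_add_left, wedge_smul_left, wedge_smul_left, wedge_self, smul_zero,
      add_zero, smul_smul, inv_mul_cancel₀ hp, one_smul]

/-- A nonzero vector annihilating a simple bivector is a factor of it. -/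
theorem exists_wedge_eq_of_wedge_mul_eq_zero {a b ξ : V4} (hξ : ξ ≠ 0)
    (h : wedge a b * ι4 ξ = 0) : ∃ v, wedge a b = wedge v ξ := by
  obtain ⟨c, hc, i, hi⟩ := exists_relation_of_ιMulti_eq_zero (K := ℝ) (v := ![a, b, ξ]) (by
    simpa [ExteriorAlgebra.ιMulti_apply, List.ofFn_succ, wedge, ι4, mul_assoc] using h)
  have hrel : c 0 • a + c 1 • b = -(c 2 • ξ) :=
    eq_neg_of_add_eq_zero_left (by simpa [Fin.sum_univ_three] using hc)
  have hpq : ¬(c 0 = 0 ∧ c 1 = 0) := by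
    rintro ⟨h₀, h₁⟩
    have h₂ : c 2 = 0 := by simpa [h₀, h₁, hξ] using hrel
    fin_cases i <;> exact hi (by assumption)
  obtain ⟨w, hw⟩ := exists_wedge_eq_wedge_combination a b hpq
  refine ⟨c 2 • w, ?_⟩
  rw [hw, hrel, wedge_neg_left, wedge_smul_left, wedge_smul_left, wedge_swap ξ w, smul_neg, neg_neg]

/-- Two simple bivectors with vanishing product share a factor, which can be taken to be either
`ξ` or the complementary factor of the second bivector `v ∧ ξ ≠ 0`. -/
theorem exists_common_factor_of_mul_eq_zero {a b v ξ : V4} (hvξ : wedge v ξ ≠ 0)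
    (h : wedge a b * wedge v ξ = 0) :
    ∃ v', wedge v ξ = wedge v' ξ ∧
      ((∃ v₀, wedge a b = wedge v₀ ξ) ∨ ∃ w₀, wedge a b = wedge v' w₀) := by
  obtain ⟨c, hc, i, hi⟩ := exists_relation_of_ιMulti_eq_zero (K := ℝ) (v := ![a, b, v, ξ]) (by
    simpa [ExteriorAlgebra.ιMulti_apply, List.ofFn_succ, wedge, ι4, mul_assoc] using h)
  have hrel : c 0 • a + c 1 • b = -(c 2 • v + c 3 • ξ) :=
    eq_neg_of_add_eq_zero_left (by simpa [Fin.sum_univ_four, add_assoc] using hc)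
  have hwedge : wedge (c 0 • a + c 1 • b) ξ = -(c 2 • wedge v ξ) := by
    rw [hrel, wedge_neg_left, wedge_add_left, wedge_smul_left, wedge_smul_left, wedge_self,
      smul_zero, add_zero]
  have hξ : ξ ≠ 0 := by
    rintro rfl
    exact hvξ (by simp [wedge_swap v])
  have hpq : ¬(c 0 = 0 ∧ c 1 = 0) := by
    rintro ⟨h₀, h₁⟩
    have h₂ : c 2 = 0 := by simpa [h₀, h₁, hvξ] using hwedge
    have h₃ : c 3 = 0 := by simpa [h₀, h₁, h₂, hξ] using hrel
    fin_cases i <;> exact hi (by assumption)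
  obtain ⟨w, hw⟩ := exists_wedge_eq_wedge_combination a b hpq
  by_cases h₂ : c 2 = 0
  · refine ⟨v, rfl, Or.inl ⟨c 3 • w, ?_⟩⟩
    rw [hw, hrel, h₂, zero_smul, zero_add, wedge_neg_left, wedge_smul_left, wedge_smul_left,
      wedge_swap ξ w, smul_neg, neg_neg]
  · refine ⟨(-(c 2)⁻¹) • (c 0 • a + c 1 • b), ?_, Or.inr ⟨(-c 2) • w, ?_⟩⟩
    · rw [wedge_smul_left, hwedge, smul_neg, neg_smul, neg_neg, smul_smul, inv_mul_cancel₀ h₂,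
        one_smul]
    · rw [wedge_smul_left, wedge_smul_right, smul_smul, neg_mul_neg, inv_mul_cancel₀ h₂, one_smul,
        hw]

theorem IsSimple.mul_self {ω : Ext4} (h : IsSimple ω) : ω * ω = 0 := by
  obtain ⟨a, b, rfl⟩ := h
  exact wedge_mul_wedge_left a b b

theorem IsSimple.mul_eq_zero_of_add {ω₀ ω : Ext4} (h₀ : IsSimple ω₀) (h : IsSimple ω)
    (hsum : IsSimple (ω₀ + ω)) : ω₀ * ω = 0 := by
  have hsq := hsum.mul_self
  have hcomm : ω * ω₀ = ω₀ * ω := by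
    obtain ⟨a, b, rfl⟩ := h₀
    obtain ⟨c, d, rfl⟩ := h
    exact wedge_mul_comm c d a b
  rw [add_mul, mul_add, mul_add, h₀.mul_self, h.mul_self, hcomm, zero_add, add_zero,
    ← two_smul ℝ] at hsq
  exact (smul_eq_zero.mp hsq).resolve_left two_ne_zero

/-- Let ω₀, ω be simple bivectors with ω ≠ 0 and let ξ ∈ ℝ⁴ with ξ_x ≠ 0 and
ω∧ξ = 0.  TFAE: (i) ω₀ + tω is simple for all t ∈ ℝ; (ii) ω₀∧ω = 0; (iii) there
is v with ω = v∧ξ and either ω₀ = v₀∧ξ for some v₀ or ω₀ = v∧w₀ for some w₀. -/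
theorem stmt4 (ω₀ ω : Ext4) (h₀ : IsSimple ω₀) (hs : IsSimple ω) (hω : ω ≠ 0)
    (ξ : V4) (hξ : spatialNonzero ξ) (hωξ : ω * ι4 ξ = 0) :
    ((∀ t : ℝ, IsSimple (ω₀ + t • ω)) ↔ ω₀ * ω = 0) ∧
    ((∀ t : ℝ, IsSimple (ω₀ + t • ω)) ↔
      ∃ v : V4, ω = wedge v ξ ∧
        ((∃ v₀ : V4, ω₀ = wedge v₀ ξ) ∨ (∃ w₀ : V4, ω₀ = wedge v w₀))) := by
  have hξ0 : ξ ≠ 0 := by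
    rintro rfl
    exact hξ ⟨rfl, rfl, rfl⟩
  have mul_of_simple : (∀ t : ℝ, IsSimple (ω₀ + t • ω)) → ω₀ * ω = 0 := fun h =>
    h₀.mul_eq_zero_of_add hs (by simpa using h 1)
  have factors_of_mul : ω₀ * ω = 0 → ∃ v : V4, ω = wedge v ξ ∧
      ((∃ v₀ : V4, ω₀ = wedge v₀ ξ) ∨ (∃ w₀ : V4, ω₀ = wedge v w₀)) := by
    intro h
    obtain ⟨a, b, rfl⟩ := h₀
    obtain ⟨c, d, rfl⟩ := hs
    obtain ⟨v, hv⟩ := exists_wedge_eq_of_wedge_mul_eq_zero hξ0 hωξ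
    rw [hv] at h hω ⊢
    exact exists_common_factor_of_mul_eq_zero hω h
  have simple_of_factors : (∃ v : V4, ω = wedge v ξ ∧
      ((∃ v₀ : V4, ω₀ = wedge v₀ ξ) ∨ (∃ w₀ : V4, ω₀ = wedge v w₀))) →
      ∀ t : ℝ, IsSimple (ω₀ + t • ω) := by
    rintro ⟨v, rfl, ⟨v₀, rfl⟩ | ⟨w₀, rfl⟩⟩ t
    · exact ⟨v₀ + t • v, ξ, by rw [wedge_add_left, wedge_smul_left]⟩
    · exact ⟨v, w₀ + t • ξ, by rw [wedge_add_right, wedge_smul_right]⟩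
  exact ⟨⟨mul_of_simple, simple_of_factors ∘ factors_of_mul⟩,
    ⟨factors_of_mul ∘ mul_of_simple, simple_of_factors⟩⟩
end
end

section
/- Let v₁, w₁, v₂, w₂ ∈ ℝ⁴ be unit vectors with v₁·w₁ = v₂·w₂ = 0, and let 0 < ε < 1. If ‖v₁∧w₁ − v₂∧w₂‖ < ε, then there exist unit vectors ṽ₂, w̃₂ ∈ ℝ⁴ with ṽ₂·w̃₂ = 0 such that ṽ₂∧w̃₂ = v₂∧w₂ (equality of the associated alternating forms), |v₁ − ṽ₂| < √2·ε and |w₁ − w̃₂| < √2·ε. -/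
noncomputable section

/-- Euclidean inner product on ℝ⁴. -/
def dot4 (a b : V4) : ℝ := ∑ i, a i * b i

/-- Euclidean norm on ℝ⁴. -/
def eNorm4 (a : V4) : ℝ := Real.sqrt (∑ i, (a i) ^ 2)

/-- The alternating bilinear form a∧b on ℝ⁴:
(a∧b)(f,g) = (a·f)(b·g) − (a·g)(b·f). -/
def wform (a b : V4) (f g : V4) : ℝ := dot4 a f * dot4 b g - dot4 a g * dot4 b f

/-- The norm ‖ω‖ = sup{ ω(f,g) : |f| = |g| = 1 } of a bilinear form on ℝ⁴. -/
def formNorm (ω : V4 → V4 → ℝ) : ℝ :=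
  sSup {r : ℝ | ∃ f g : V4, eNorm4 f = 1 ∧ eNorm4 g = 1 ∧ r = ω f g}

/-- The rotation of `v` towards `w` by the angle `t`. -/
def rot4 (t : ℝ) (v w : V4) : V4 := Real.cos t • v + Real.sin t • w

lemma dot4_comm (a b : V4) : dot4 a b = dot4 b a := by
  simp only [dot4, mul_comm]

lemma dot4_add_left (a b c : V4) : dot4 (a + b) c = dot4 a c + dot4 b c := by
  simp only [dot4, Pi.add_apply, add_mul, Finset.sum_add_distrib]

lemma dot4_smul_left (r : ℝ) (a b : V4) : dot4 (r • a) b = r * dot4 a b := by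
  simp only [dot4, Pi.smul_apply, smul_eq_mul, mul_assoc, Finset.mul_sum]

lemma dot4_sub_left (a b c : V4) : dot4 (a - b) c = dot4 a c - dot4 b c := by
  simp only [dot4, Pi.sub_apply, sub_mul, Finset.sum_sub_distrib]

lemma dot4_add_right (a b c : V4) : dot4 c (a + b) = dot4 c a + dot4 c b := by
  simp only [dot4_comm c, dot4_add_left]

lemma dot4_smul_right (r : ℝ) (a b : V4) : dot4 b (r • a) = r * dot4 b a := by
  simp only [dot4_comm b, dot4_smul_left]

lemma dot4_sub_right (a b c : V4) : dot4 c (a - b) = dot4 c a - dot4 c b := by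
  simp only [dot4_comm c, dot4_sub_left]

lemma dot4_self_nonneg (a : V4) : 0 ≤ dot4 a a :=
  Finset.sum_nonneg fun i _ => mul_self_nonneg (a i)

lemma eNorm4_eq_sqrt_dot4 (a : V4) : eNorm4 a = √(dot4 a a) := by
  simp only [eNorm4, dot4, sq]

lemma eNorm4_eq_one_iff (a : V4) : eNorm4 a = 1 ↔ dot4 a a = 1 := by
  rw [eNorm4_eq_sqrt_dot4, Real.sqrt_eq_one]

lemma abs_dot4_le_one {a b : V4} (ha : dot4 a a = 1) (hb : dot4 b b = 1) :
    |dot4 a b| ≤ 1 := by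
  have hs := dot4_self_nonneg (a - b)
  have hp := dot4_self_nonneg (a + b)
  simp only [dot4_sub_left, dot4_sub_right, dot4_add_left, dot4_add_right, ha, hb,
    dot4_comm b a] at hs hp
  exact abs_le.mpr ⟨by linarith, by linarith⟩

lemma abs_wform_le_two {a b f g : V4} (ha : dot4 a a = 1) (hb : dot4 b b = 1)
    (hf : dot4 f f = 1) (hg : dot4 g g = 1) : |wform a b f g| ≤ 2 := by
  have h₁ : |dot4 a f * dot4 b g| ≤ 1 := by
    rw [abs_mul]
    exact mul_le_one₀ (abs_dot4_le_one ha hf) (abs_nonneg _) (abs_dot4_le_one hb hg)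
  have h₂ : |dot4 a g * dot4 b f| ≤ 1 := by
    rw [abs_mul]
    exact mul_le_one₀ (abs_dot4_le_one ha hg) (abs_nonneg _) (abs_dot4_le_one hb hf)
  calc |wform a b f g| ≤ |dot4 a f * dot4 b g| + |dot4 a g * dot4 b f| := abs_sub _ _
    _ ≤ 2 := by linarith

lemma wform_sub_le_formNorm {v₁ w₁ v₂ w₂ f g : V4}
    (hv₁ : dot4 v₁ v₁ = 1) (hw₁ : dot4 w₁ w₁ = 1)
    (hv₂ : dot4 v₂ v₂ = 1) (hw₂ : dot4 w₂ w₂ = 1)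
    (hf : dot4 f f = 1) (hg : dot4 g g = 1) :
    wform v₁ w₁ f g - wform v₂ w₂ f g ≤
      formNorm (fun f g => wform v₁ w₁ f g - wform v₂ w₂ f g) := by
  refine le_csSup ⟨4, ?_⟩
    ⟨f, g, (eNorm4_eq_one_iff f).mpr hf, (eNorm4_eq_one_iff g).mpr hg, rfl⟩
  rintro r ⟨x, y, hx, hy, rfl⟩
  rw [eNorm4_eq_one_iff] at hx hy
  have h₁ := abs_le.mp (abs_wform_le_two hv₁ hw₁ hx hy)
  have h₂ := abs_le.mp (abs_wform_le_two hv₂ hw₂ hx hy)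
  linarith [h₁.2, h₂.1]

/-- If `u` represents `ω(f, ·)` for a unit vector `f`, then `|u| ≤ ‖ω‖`. -/
lemma dot4_self_lt_sq_of_formNorm_lt {v₁ w₁ v₂ w₂ f u : V4} {ε : ℝ}
    (hv₁ : dot4 v₁ v₁ = 1) (hw₁ : dot4 w₁ w₁ = 1)
    (hv₂ : dot4 v₂ v₂ = 1) (hw₂ : dot4 w₂ w₂ = 1) (hf : dot4 f f = 1) (hε : 0 < ε)
    (hclose : formNorm (fun f g => wform v₁ w₁ f g - wform v₂ w₂ f g) < ε)
    (hu : ∀ g, wform v₁ w₁ f g - wform v₂ w₂ f g = dot4 u g) :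
    dot4 u u < ε ^ 2 := by
  rcases (dot4_self_nonneg u).eq_or_lt with h0 | hpos
  · rw [← h0]
    positivity
  · have hr : 0 < √(dot4 u u) := Real.sqrt_pos.mpr hpos
    have hsq := Real.sq_sqrt hpos.le
    have hg : dot4 ((√(dot4 u u))⁻¹ • u) ((√(dot4 u u))⁻¹ • u) = 1 := by
      rw [dot4_smul_left, dot4_smul_right]
      field_simp
      exact hsq.symm
    have h := (wform_sub_le_formNorm hv₁ hw₁ hv₂ hw₂ hf hg).trans_lt hclose
    rw [hu, dot4_smul_right] at h
    have he : (√(dot4 u u))⁻¹ * dot4 u u = √(dot4 u u) := by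
      field_simp
      exact hsq.symm
    rw [he] at h
    exact (Real.sqrt_lt' hε).mp h

lemma dot4_rot4 (s t : ℝ) (a b c d : V4) :
    dot4 (rot4 s a b) (rot4 t c d) =
      Real.cos s * (Real.cos t * dot4 a c + Real.sin t * dot4 a d) +
        Real.sin s * (Real.cos t * dot4 b c + Real.sin t * dot4 b d) := by
  simp only [rot4, dot4_add_left, dot4_add_right, dot4_smul_left, dot4_smul_right]
  ring

/-- Rotating an orthonormal pair inside its plane gives an orthonormal pair. -/
lemma dot4_rot4_orthonormal (t : ℝ) {v w : V4} (hv : dot4 v v = 1) (hw : dot4 w w = 1)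
    (h : dot4 v w = 0) :
    dot4 (rot4 t v w) (rot4 t v w) = 1 ∧ dot4 (rot4 t w (-v)) (rot4 t w (-v)) = 1 ∧
      dot4 (rot4 t v w) (rot4 t w (-v)) = 0 := by
  have hn : -v = (-1 : ℝ) • v := by simp
  have hcs := Real.cos_sq_add_sin_sq t
  rw [hn]
  simp only [dot4_rot4, dot4_smul_left, dot4_smul_right, dot4_comm w v, hv, hw, h]
  refine ⟨?_, ?_, ?_⟩
  · linear_combination hcs
  · linear_combination hcs
  · ring

lemma wform_rot4 (t : ℝ) (v w f g : V4) :
    wform (rot4 t v w) (rot4 t w (-v)) f g = wform v w f g := by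
  have hn : -v = (-1 : ℝ) • v := by simp
  rw [hn]
  simp only [wform, rot4, dot4_add_left, dot4_smul_left]
  linear_combination
    (dot4 v f * dot4 w g - dot4 v g * dot4 w f) * Real.cos_sq_add_sin_sq t

lemma rot4_neg_rot4 (t : ℝ) (v w : V4) :
    rot4 (-t) (rot4 t v w) (rot4 t w (-v)) = v ∧
      rot4 (-t) (rot4 t w (-v)) (-rot4 t v w) = w := by
  have hcs := Real.cos_sq_add_sin_sq t
  constructor <;> ext i <;>
    simp only [rot4, Real.cos_neg, Real.sin_neg, Pi.add_apply, Pi.smul_apply, Pi.neg_apply,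
      smul_eq_mul]
  · linear_combination v i * hcs
  · linear_combination w i * hcs

lemma exists_polar (x y : ℝ) :
    ∃ r t : ℝ, 0 ≤ r ∧ x = r * Real.cos t ∧ y = r * Real.sin t :=
  ⟨‖(⟨x, y⟩ : ℂ)‖, Complex.arg ⟨x, y⟩, norm_nonneg _,
    (Complex.norm_mul_cos_arg ⟨x, y⟩).symm, (Complex.norm_mul_sin_arg ⟨x, y⟩).symm⟩

/-- Principal vectors: rotations of two pairs of vectors making their Gram matrix diagonal. -/
lemma exists_principal_rotations (v₁ w₁ v₂ w₂ : V4) :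
    ∃ s t : ℝ, dot4 (rot4 s v₁ w₁) (rot4 t w₂ (-v₂)) = 0 ∧
      dot4 (rot4 s w₁ (-v₁)) (rot4 t v₂ w₂) = 0 ∧
      |dot4 (rot4 s w₁ (-v₁)) (rot4 t w₂ (-v₂))| ≤ dot4 (rot4 s v₁ w₁) (rot4 t v₂ w₂) := by
  have hn₁ : -v₁ = (-1 : ℝ) • v₁ := by simp
  have hn₂ : -v₂ = (-1 : ℝ) • v₂ := by simp
  obtain ⟨p, α, hp, hx, hy⟩ :=
    exists_polar (dot4 v₁ v₂ + dot4 w₁ w₂) (dot4 v₁ w₂ - dot4 w₁ v₂)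
  obtain ⟨q, β, hq, hz, hw⟩ :=
    exists_polar (dot4 v₁ v₂ - dot4 w₁ w₂) (dot4 v₁ w₂ + dot4 w₁ v₂)
  obtain ⟨s, t, rfl, rfl⟩ : ∃ s t : ℝ, α = t - s ∧ β = t + s :=
    ⟨(β - α) / 2, (α + β) / 2, by ring, by ring⟩
  have ha : dot4 v₁ v₂ = (p * Real.cos (t - s) + q * Real.cos (t + s)) / 2 := by linarith
  have hd : dot4 w₁ w₂ = (p * Real.cos (t - s) - q * Real.cos (t + s)) / 2 := by linarith
  have hb : dot4 v₁ w₂ = (p * Real.sin (t - s) + q * Real.sin (t + s)) / 2 := by linarith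
  have hc : dot4 w₁ v₂ = (q * Real.sin (t + s) - p * Real.sin (t - s)) / 2 := by linarith
  have hs := Real.cos_sq_add_sin_sq s
  have ht := Real.cos_sq_add_sin_sq t
  have h₁ : dot4 (rot4 s v₁ w₁) (rot4 t v₂ w₂) = (p + q) / 2 := by
    simp only [dot4_rot4, ha, hb, hc, hd, Real.cos_add, Real.cos_sub, Real.sin_add,
      Real.sin_sub]
    linear_combination (p + q) / 2 * ht +
      (p + q) / 2 * (Real.cos t ^ 2 + Real.sin t ^ 2) * hs
  have h₂ : dot4 (rot4 s w₁ (-v₁)) (rot4 t w₂ (-v₂)) = (p - q) / 2 := by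
    rw [hn₁, hn₂]
    simp only [dot4_rot4, dot4_smul_left, dot4_smul_right, ha, hb, hc, hd, Real.cos_add,
      Real.cos_sub, Real.sin_add, Real.sin_sub]
    linear_combination (p - q) / 2 * ht +
      (p - q) / 2 * (Real.cos t ^ 2 + Real.sin t ^ 2) * hs
  refine ⟨s, t, ?_, ?_, ?_⟩
  · rw [hn₂]
    simp only [dot4_rot4, dot4_smul_right, ha, hb, hc, hd, Real.cos_add, Real.cos_sub,
      Real.sin_add, Real.sin_sub]
    ring
  · rw [hn₁]
    simp only [dot4_rot4, dot4_smul_left, ha, hb, hc, hd, Real.cos_add, Real.cos_sub,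
      Real.sin_add, Real.sin_sub]
    ring
  · rw [h₁, h₂, abs_le]
    constructor <;> linarith

lemma eNorm4_sub_lt {a b : V4} {ε : ℝ} (ha : dot4 a a = 1) (hb : dot4 b b = 1) (hε : 0 < ε)
    (h : 1 - dot4 a b < ε ^ 2) : eNorm4 (a - b) < √2 * ε := by
  rw [eNorm4_eq_sqrt_dot4, Real.sqrt_lt' (by positivity), mul_pow, Real.sq_sqrt zero_le_two]
  simp only [dot4_sub_left, dot4_sub_right, ha, hb, dot4_comm b a]
  linarith

/-- If v₁, w₁, v₂, w₂ are unit vectors in ℝ⁴ with v₁·w₁ = v₂·w₂ = 0, 0 < ε < 1 and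
‖v₁∧w₁ − v₂∧w₂‖ < ε, then there are orthogonal unit vectors ṽ₂, w̃₂ with
ṽ₂∧w̃₂ = v₂∧w₂, |v₁ − ṽ₂| < √2·ε and |w₁ − w̃₂| < √2·ε. -/
theorem stmt8 (v₁ w₁ v₂ w₂ : V4)
    (hv₁ : eNorm4 v₁ = 1) (hw₁ : eNorm4 w₁ = 1)
    (hv₂ : eNorm4 v₂ = 1) (hw₂ : eNorm4 w₂ = 1)
    (h₁ : dot4 v₁ w₁ = 0) (h₂ : dot4 v₂ w₂ = 0)
    (ε : ℝ) (hε0 : 0 < ε) (hε1 : ε < 1)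
    (hclose : formNorm (fun f g => wform v₁ w₁ f g - wform v₂ w₂ f g) < ε) :
    ∃ v' w' : V4, eNorm4 v' = 1 ∧ eNorm4 w' = 1 ∧ dot4 v' w' = 0 ∧
      (∀ f g : V4, wform v' w' f g = wform v₂ w₂ f g) ∧
      eNorm4 (v₁ - v') < Real.sqrt 2 * ε ∧ eNorm4 (w₁ - w') < Real.sqrt 2 * ε := by
  rw [eNorm4_eq_one_iff] at hv₁ hw₁ hv₂ hw₂
  obtain ⟨s, t, h12, h21, hle⟩ := exists_principal_rotations v₁ w₁ v₂ w₂
  obtain ⟨he₁, he₂, he⟩ := dot4_rot4_orthonormal s hv₁ hw₁ h₁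
  obtain ⟨hf₁, hf₂, hf⟩ := dot4_rot4_orthonormal t hv₂ hw₂ h₂
  have hω₁ := wform_rot4 s v₁ w₁
  have hω₂ := wform_rot4 t v₂ w₂
  obtain ⟨hv, hw⟩ := rot4_neg_rot4 s v₁ w₁
  set e₁ := rot4 s v₁ w₁
  set e₂ := rot4 s w₁ (-v₁)
  set f₁ := rot4 t v₂ w₂
  set f₂ := rot4 t w₂ (-v₂)
  obtain ⟨hv', hw', hvw'⟩ := dot4_rot4_orthonormal (-s) hf₁ hf₂ hf
  have hu := dot4_self_lt_sq_of_formNorm_lt (u := e₂ - dot4 e₁ f₁ • f₂)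
    hv₁ hw₁ hv₂ hw₂ he₁ hε0 hclose fun g => by
      rw [← hω₁, ← hω₂]
      simp only [wform, dot4_sub_left, dot4_smul_left, he₁, dot4_comm e₂ e₁, he,
        dot4_comm f₁ e₁, dot4_comm f₂ e₁, h12]
      ring
  simp only [dot4_sub_left, dot4_sub_right, dot4_smul_left, dot4_smul_right, he₂, hf₂,
    dot4_comm f₂ e₂] at hu
  have hc₂ := (abs_le.mp (abs_dot4_le_one he₂ hf₂)).2
  have hc := (abs_le.mp hle).2
  have hc₁ := (abs_nonneg _).trans hle
  have hc₂_pos : 0 < dot4 e₂ f₂ := by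
    by_contra! hneg
    nlinarith
  have key : 1 - dot4 e₂ f₂ < ε ^ 2 := by
    nlinarith [sq_nonneg (dot4 e₁ f₁ - dot4 e₂ f₂)]
  have hn : ∀ x : V4, -x = (-1 : ℝ) • x := fun x => by simp
  have hcs := Real.cos_sq_add_sin_sq s
  refine ⟨rot4 (-s) f₁ f₂, rot4 (-s) f₂ (-f₁), (eNorm4_eq_one_iff _).mpr hv',
    (eNorm4_eq_one_iff _).mpr hw', hvw', fun f g => (wform_rot4 _ _ _ _ _).trans (hω₂ f g),
    eNorm4_sub_lt hv₁ hv' hε0 ?_, eNorm4_sub_lt hw₁ hw' hε0 ?_⟩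
  · refine lt_of_le_of_lt ?_ key
    rw [← hv]
    simp only [dot4_rot4, h12, h21, Real.cos_neg, Real.sin_neg]
    nlinarith [mul_nonneg (sq_nonneg (Real.cos s)) (sub_nonneg.mpr hc)]
  · refine lt_of_le_of_lt ?_ key
    rw [← hw, hn e₁, hn f₁]
    simp only [dot4_rot4, dot4_smul_left, dot4_smul_right, h12, h21, Real.cos_neg,
      Real.sin_neg]
    nlinarith [mul_nonneg (sq_nonneg (Real.sin s)) (sub_nonneg.mpr hc)]
end
end

section
/- Suppose 𝒰 ⊆ ℳ is bounded and relatively open in ℳ. Then 𝒰^{lc,Λ} = 𝒰^{lc,Λ_g}. -/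
noncomputable section

/-- Euclidean norm on ℝ³. -/
def eNorm3 (a : V3) : ℝ := Real.sqrt (∑ i, (a i) ^ 2)

/-- The Euclidean norm on the state space. -/
def stateNorm (V : MHDState) : ℝ :=
  Real.sqrt ((∑ i, (V.1 i) ^ 2) + (∑ i, ∑ j, (V.2.1 i j) ^ 2) +
    (∑ i, (V.2.2.1 i) ^ 2) + (∑ i, (V.2.2.2 i) ^ 2))

/-- The wave cone Λ: states with symmetric S admitting some ξ with ξ_x ≠ 0
annihilating them. -/
def WaveCone : Set MHDState :=
  {V | V.2.1.IsSymm ∧ ∃ ξx : V3, ∃ ξt : ℝ, ξx ≠ 0 ∧ Annihilates ξx ξt V}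

/-- The set ℳ of states (with symmetric S) satisfying B·E = 0. -/
def MSet : Set MHDState :=
  {V | V.2.1.IsSymm ∧ dot3 V.2.2.1 V.2.2.2 = 0}

/-- The segment [V₀ − (1−λ)V, V₀ + λV] is a good Λ-segment. -/
def GoodSegment (V₀ V : MHDState) (lam : ℝ) : Prop :=
  V₀ ∈ MSet ∧ V ∈ WaveCone ∧ 0 < lam ∧ lam < 1 ∧
  (∀ t : ℝ, -(1 - lam) ≤ t → t ≤ lam → V₀ + t • V ∈ MSet) ∧
  ∃ ξx : V3, ∃ ξt : ℝ, ξx ≠ 0 ∧ Annihilates ξx ξt V ∧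
    ((V.2.2.1 = 0 ∧ V.2.2.2 = 0) ∨
     (dot3 ξx V₀.2.2.1 ≠ 0 ∨ ξt • V₀.2.2.1 + cross3 ξx V₀.2.2.2 ≠ 0) ∨
     (∃ k : ℝ, k ≠ -(1 / lam) ∧ k ≠ 1 / (1 - lam) ∧
       V.2.2.1 = k • V₀.2.2.1 ∧ V.2.2.2 = k • V₀.2.2.2 ∧
       ¬(V.2.2.1 = 0 ∧ V.2.2.2 = 0)) ∨
     (V.1 = 0 ∧ V.2.1 = 0 ∧ V₀.2.2.1 = 0 ∧ V₀.2.2.2 = 0))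

/-- The iterated lamination sets Y^{N,Λ}. -/
def lamHull (Y : Set MHDState) : ℕ → Set MHDState
  | 0 => Y
  | N + 1 => lamHull Y N ∪
      {Z | ∃ lam : ℝ, ∃ V W : MHDState, 0 ≤ lam ∧ lam ≤ 1 ∧
        V ∈ lamHull Y N ∧ W ∈ lamHull Y N ∧ V - W ∈ WaveCone ∧
        Z = lam • V + (1 - lam) • W}

/-- The lamination convex hull Y^{lc,Λ}. -/
def lcHull (Y : Set MHDState) : Set MHDState := ⋃ N : ℕ, lamHull Y N

/-- The iterated good lamination sets Y^{k,Λ_g}. -/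
def lamHullG (Y : Set MHDState) : ℕ → Set MHDState
  | 0 => Y
  | k + 1 => lamHullG Y k ∪
      {V₀ | ∃ lam : ℝ, ∃ V : MHDState, GoodSegment V₀ V lam ∧
        V₀ + lam • V ∈ lamHullG Y k ∧ V₀ - (1 - lam) • V ∈ lamHullG Y k}

/-- The good lamination convex hull Y^{lc,Λ_g}. -/
def lcHullG (Y : Set MHDState) : Set MHDState := ⋃ k : ℕ, lamHullG Y k

/-- A set of states is relatively open in ℳ. -/
def RelOpen (U : Set MHDState) : Prop :=
  ∀ V ∈ U, ∃ δ : ℝ, 0 < δ ∧ ∀ W ∈ MSet, stateNorm (W - V) < δ → W ∈ U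

/-- The tensor product a⊗b of two vectors in ℝ³. -/
def outer (a b : V3) : Mat3 := Matrix.of fun i j => a i * b j

/-- The constitutive set K_{r,s}. -/
def Kset (r s : ℝ) : Set MHDState :=
  {V | ∃ q : ℝ, |q| ≤ r * s ∧
    V.2.1 = outer V.1 V.1 - outer V.2.2.1 V.2.2.1 + q • (1 : Mat3) ∧
    V.2.2.2 = cross3 V.2.2.1 V.1 ∧
    eNorm3 (V.1 + V.2.2.1) = r ∧ eNorm3 (V.1 - V.2.2.1) = s}

/-- 𝒰_{r,s}: the relative interior of K_{r,s}^{lc,Λ} in ℳ. -/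
def Uset (r s : ℝ) : Set MHDState :=
  {V | V ∈ MSet ∧ ∃ δ : ℝ, 0 < δ ∧
    ∀ W ∈ MSet, stateNorm (W - V) < δ → W ∈ lcHull (Kset r s)}

/-- The Frobenius norm on 3×3 matrices. -/
def frobNorm (M : Mat3) : ℝ := Real.sqrt (∑ i, ∑ j, (M i j) ^ 2)

/-- The relatively open sets 𝒱_{r',s',c}. -/
def Vset (r' s' c : ℝ) : Set MHDState :=
  {V | V.2.1.IsSymm ∧ dot3 V.2.2.1 V.2.2.2 = 0 ∧ ∃ q : ℝ,
    eNorm3 (V.1 + V.2.2.1) < r' + c ∧ eNorm3 (V.1 - V.2.2.1) < s' + c ∧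
    frobNorm (V.2.1 - (outer V.1 V.1 - outer V.2.2.1 V.2.2.1) - q • (1 : Mat3)) < c ∧
    |q| < r' * s' + c ∧ eNorm3 (V.2.2.2 - cross3 V.2.2.1 V.1) < c}

open Filter Topology

/-- The magnetic part of the wedge product of two covectors `(a_x, a_t)` and `(b_x, b_t)`. -/
def wedgeB (a b : V3 × ℝ) : V3 := cross3 a.1 b.1

/-- The electric part of the wedge product of two covectors `(a_x, a_t)` and `(b_x, b_t)`. -/
def wedgeE (a b : V3 × ℝ) : V3 := b.2 • a.1 - a.2 • b.1

/-- The wedge product of `ξ` with the two-form `(B, E)` vanishes. -/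
def FormAnn (ξ : V3 × ℝ) (B E : V3) : Prop :=
  dot3 ξ.1 B = 0 ∧ ξ.2 • B + cross3 ξ.1 E = 0

/-- The polarization of `B·E`, so that a simple two-form plus a simple two-form is simple
iff this vanishes. -/
def polar (B E B' E' : V3) : ℝ := dot3 B E' + dot3 B' E

/-- The contraction of the two-form `(B, E)` with the vector `X`. -/
def contract (X : V3 × ℝ) (B E : V3) : V3 × ℝ :=
  (cross3 B X.1 - X.2 • E, dot3 X.1 E)

/-- The value of the two-form `(B, E)` at the pair of vectors `X`, `Y`. -/
def formEval (X Y : V3 × ℝ) (B E : V3) : ℝ :=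
  dot3 (contract X B E).1 Y.1 + (contract X B E).2 * Y.2

theorem cross3_zero (a b : V3) : cross3 a b 0 = a 1 * b 2 - a 2 * b 1 := rfl

theorem cross3_one (a b : V3) : cross3 a b 1 = a 2 * b 0 - a 0 * b 2 := rfl

theorem cross3_two (a b : V3) : cross3 a b 2 = a 0 * b 1 - a 1 * b 0 := rfl

theorem vec3_ext_iff (a b : V3) : a = b ↔ a 0 = b 0 ∧ a 1 = b 1 ∧ a 2 = b 2 := by
  constructor
  · rintro rfl; simp
  · rintro ⟨h0, h1, h2⟩
    ext i
    fin_cases i <;> assumption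

theorem formAnn_iff (ξ : V3 × ℝ) (B E : V3) : FormAnn ξ B E ↔
    ξ.1 0 * B 0 + ξ.1 1 * B 1 + ξ.1 2 * B 2 = 0 ∧
    ξ.2 * B 0 + (ξ.1 1 * E 2 - ξ.1 2 * E 1) = 0 ∧
    ξ.2 * B 1 + (ξ.1 2 * E 0 - ξ.1 0 * E 2) = 0 ∧
    ξ.2 * B 2 + (ξ.1 0 * E 1 - ξ.1 1 * E 0) = 0 := by
  simp [FormAnn, dot3, cross3_zero, cross3_one, cross3_two, vec3_ext_iff, Fin.sum_univ_three]

theorem sq_sum_ne_zero {n : V3} (hn : n ≠ 0) : n 0 ^ 2 + n 1 ^ 2 + n 2 ^ 2 ≠ 0 := by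
  intro h
  apply hn
  rw [vec3_ext_iff]
  simp only [Pi.zero_apply]
  refine ⟨?_, ?_, ?_⟩ <;> nlinarith [sq_nonneg (n 0), sq_nonneg (n 1), sq_nonneg (n 2)]

theorem formAnn_wedge_left (ξ η : V3 × ℝ) : FormAnn ξ (wedgeB ξ η) (wedgeE ξ η) := by
  rw [formAnn_iff]
  simp [wedgeB, wedgeE, cross3_zero, cross3_one, cross3_two]
  refine ⟨?_, ?_, ?_, ?_⟩ <;> ring

theorem formAnn_wedge_right (ξ η : V3 × ℝ) : FormAnn η (wedgeB ξ η) (wedgeE ξ η) := by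
  rw [formAnn_iff]
  simp [wedgeB, wedgeE, cross3_zero, cross3_one, cross3_two]
  refine ⟨?_, ?_, ?_, ?_⟩ <;> ring

theorem dot3_wedge (a b : V3 × ℝ) : dot3 (wedgeB a b) (wedgeE a b) = 0 := by
  simp [wedgeB, wedgeE, cross3_zero, cross3_one, cross3_two, dot3, Fin.sum_univ_three]
  ring

theorem exists_wedge_of_formAnn {ξ : V3 × ℝ} (hξ : ξ.1 ≠ 0) {B E : V3} (h : FormAnn ξ B E) :
    ∃ η : V3 × ℝ, η.1 ≠ 0 ∧ B = wedgeB ξ η ∧ E = wedgeE ξ η := by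
  obtain ⟨⟨n, t⟩, rfl⟩ : ∃ x, ξ = x := ⟨_, rfl⟩
  have hd := sq_sum_ne_zero hξ
  rw [formAnn_iff] at h
  simp only at hξ hd h
  obtain ⟨h0, h1, h2, h3⟩ := h
  set d := n 0 ^ 2 + n 1 ^ 2 + n 2 ^ 2 with hdd
  have key : ∀ c : ℝ,
      B = wedgeB (n, t) (d⁻¹ • cross3 B n + c • n, d⁻¹ * dot3 E n + c * t) ∧
      E = wedgeE (n, t) (d⁻¹ • cross3 B n + c • n, d⁻¹ * dot3 E n + c * t) := by
    intro c
    simp only [vec3_ext_iff, wedgeB, wedgeE]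
    simp [cross3_zero, cross3_one, cross3_two, dot3, Fin.sum_univ_three]
    refine ⟨⟨?_, ?_, ?_⟩, ?_, ?_, ?_⟩ <;> field_simp
    · linear_combination (B 0) * hdd + n 0 * h0
    · linear_combination (B 1) * hdd + n 1 * h0
    · linear_combination (B 2) * hdd + n 2 * h0
    · linear_combination (E 0) * hdd - n 1 * h3 + n 2 * h2
    · linear_combination (E 1) * hdd - n 2 * h1 + n 0 * h3
    · linear_combination (E 2) * hdd - n 0 * h2 + n 1 * h1
  by_cases hz : d⁻¹ • cross3 B n + (0 : ℝ) • n = 0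
  · refine ⟨_, ?_, key 1⟩
    simp only [zero_smul, add_zero] at hz
    simpa [hz] using hξ
  · exact ⟨_, hz, key 0⟩

theorem contract_wedge (X a b : V3 × ℝ) : contract X (wedgeB a b) (wedgeE a b) =
    (dot3 X.1 a.1 + X.2 * a.2) • b - (dot3 X.1 b.1 + X.2 * b.2) • a := by
  ext i
  · fin_cases i <;> simp [contract, wedgeB, wedgeE, cross3_zero, cross3_one, cross3_two,
      dot3, Fin.sum_univ_three] <;> ring
  · simp [contract, wedgeB, wedgeE, dot3, Fin.sum_univ_three, cross3]
    ring

theorem wedge_contract (X Y : V3 × ℝ) {B E : V3} (h : dot3 B E = 0) :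
    wedgeB (contract X B E) (contract Y B E) = formEval X Y B E • B ∧
    wedgeE (contract X B E) (contract Y B E) = formEval X Y B E • E := by
  simp only [vec3_ext_iff]
  simp [contract, formEval, wedgeB, wedgeE, cross3_zero, cross3_one, cross3_two, dot3,
    Fin.sum_univ_three] at h ⊢
  refine ⟨⟨?_, ?_, ?_⟩, ?_, ?_, ?_⟩
  · grind
  · grind
  · grind
  · grind
  · grind
  · grind

theorem wedgeB_smul (s t : ℝ) (a b : V3 × ℝ) : wedgeB (s • a) (t • b) = (s * t) • wedgeB a b := by
  simp only [vec3_ext_iff]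
  simp [wedgeB, cross3_zero, cross3_one, cross3_two]
  refine ⟨?_, ?_, ?_⟩ <;> ring

theorem wedgeE_smul (s t : ℝ) (a b : V3 × ℝ) : wedgeE (s • a) (t • b) = (s * t) • wedgeE a b := by
  simp only [vec3_ext_iff]
  simp [wedgeE]
  refine ⟨?_, ?_, ?_⟩ <;> ring

theorem formAnn_smul {ξ : V3 × ℝ} {B E : V3} (c : ℝ) (hc : c ≠ 0) :
    FormAnn ξ (c • B) (c • E) ↔ FormAnn ξ B E := by
  simp only [formAnn_iff, Pi.smul_apply, smul_eq_mul]
  constructor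
  · rintro ⟨h0, h1, h2, h3⟩
    refine ⟨?_, ?_, ?_, ?_⟩ <;> apply mul_left_cancel₀ hc <;> linarith
  · rintro ⟨h0, h1, h2, h3⟩
    refine ⟨?_, ?_, ?_, ?_⟩
    · linear_combination c * h0
    · linear_combination c * h1
    · linear_combination c * h2
    · linear_combination c * h3

theorem formAnn_add_iff {ξ : V3 × ℝ} {B E B' E' : V3} (h : FormAnn ξ B E) :
    FormAnn ξ (B + B') (E + E') ↔ FormAnn ξ B' E' := by
  simp only [formAnn_iff, Pi.add_apply] at h ⊢
  obtain ⟨h0, h1, h2, h3⟩ := h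
  constructor
  · rintro ⟨k0, k1, k2, k3⟩
    refine ⟨?_, ?_, ?_, ?_⟩ <;> linarith
  · rintro ⟨k0, k1, k2, k3⟩
    refine ⟨?_, ?_, ?_, ?_⟩ <;> linarith

/-- The set of covectors annihilating a two-form, as a subspace. -/
def annSubmodule (B E : V3) : Submodule ℝ (V3 × ℝ) where
  carrier := {ξ | FormAnn ξ B E}
  zero_mem' := by simp [formAnn_iff]
  add_mem' := by
    intro a b ha hb
    simp only [Set.mem_ofPred_eq, formAnn_iff, Prod.fst_add, Prod.snd_add, Pi.add_apply] at *
    obtain ⟨h0, h1, h2, h3⟩ := ha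
    obtain ⟨k0, k1, k2, k3⟩ := hb
    refine ⟨?_, ?_, ?_, ?_⟩ <;> linarith
  smul_mem' := by
    intro c a ha
    simp only [Set.mem_ofPred_eq, formAnn_iff, Prod.smul_fst, Prod.smul_snd, Pi.smul_apply,
      smul_eq_mul] at *
    obtain ⟨h0, h1, h2, h3⟩ := ha
    refine ⟨?_, ?_, ?_, ?_⟩
    · linear_combination c * h0
    · linear_combination c * h1
    · linear_combination c * h2
    · linear_combination c * h3

theorem annSubmodule_ne_top {B E : V3} (h : ¬(B = 0 ∧ E = 0)) : annSubmodule B E ≠ ⊤ := by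
  intro ht
  apply h
  have key : ∀ ξ : V3 × ℝ, FormAnn ξ B E := fun ξ => by
    have : ξ ∈ annSubmodule B E := ht ▸ Submodule.mem_top
    exact this
  have k0 := (formAnn_iff _ _ _).1 (key (0, 1))
  have k1 := (formAnn_iff _ _ _).1 (key (![1, 0, 0], 0))
  have k2 := (formAnn_iff _ _ _).1 (key (![0, 1, 0], 0))
  simp at k0 k1 k2
  simp only [vec3_ext_iff, Pi.zero_apply]
  grind

theorem exists_not_formAnn {B E B' E' : V3} (h : ¬(B = 0 ∧ E = 0)) (h' : ¬(B' = 0 ∧ E' = 0)) :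
    ∃ q : V3 × ℝ, q.1 ≠ 0 ∧ ¬FormAnn q B E ∧ ¬FormAnn q B' E' := by
  by_contra! hcon
  let K : Submodule ℝ (V3 × ℝ) := LinearMap.ker (LinearMap.fst ℝ V3 ℝ)
  have hK : K ≠ ⊤ := by
    intro hK
    have : ((1, 0) : V3 × ℝ) ∈ K := hK ▸ Submodule.mem_top
    simp [K] at this
  classical
  let s : Finset (Submodule ℝ (V3 × ℝ)) := {K, annSubmodule B E, annSubmodule B' E'}
  refine Subspace.biUnion_ne_univ_of_top_notMem (s := s) ?_ ?_
  · simp only [s, Finset.mem_insert, Finset.mem_singleton, not_or]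
    exact ⟨hK.symm, (annSubmodule_ne_top h).symm, (annSubmodule_ne_top h').symm⟩
  · rw [Set.eq_univ_iff_forall]
    intro q
    simp only [s, Set.mem_iUnion, Finset.mem_insert, Finset.mem_singleton, exists_prop,
      exists_eq_or_imp, exists_eq_left]
    by_cases h1 : q.1 = 0
    · left; simpa [K] using h1
    · by_cases h2 : FormAnn q B E
      · exact Or.inr (Or.inl h2)
      · exact Or.inr (Or.inr (hcon q h1 h2))

theorem polar_wedge (a b c d : V3 × ℝ) :
    polar (wedgeB a b) (wedgeE a b) (wedgeB c d) (wedgeE c d) =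
      Matrix.det !![a.1 0, a.1 1, a.1 2, a.2; b.1 0, b.1 1, b.1 2, b.2;
        c.1 0, c.1 1, c.1 2, c.2; d.1 0, d.1 1, d.1 2, d.2] := by
  simp [Matrix.det_succ_row_zero, Fin.sum_univ_succ, polar, dot3, wedgeB, wedgeE, cross3,
    Fin.succAbove]
  ring

theorem exists_wedge_contract {ξ η a b : V3 × ℝ}
    (hp : polar (wedgeB ξ η) (wedgeE ξ η) (wedgeB a b) (wedgeE a b) = 0)
    (h : ¬FormAnn ξ (wedgeB a b) (wedgeE a b)) :
    ∃ s t : ℝ, wedgeB ξ η = wedgeB ξ (s • a + t • b) ∧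
      wedgeE ξ η = wedgeE ξ (s • a + t • b) := by
  rw [polar_wedge] at hp
  obtain ⟨c, hc, hc'⟩ := Matrix.exists_vecMul_eq_zero_iff.2 hp
  have e0 := congrFun hc' 0
  have e1 := congrFun hc' 1
  have e2 := congrFun hc' 2
  have e3 := congrFun hc' 3
  simp [Matrix.vecMul, dotProduct, Fin.sum_univ_succ] at e0 e1 e2 e3
  have h1 : c 1 ≠ 0 := by
    intro h1
    apply h
    rw [formAnn_iff]
    simp only [h1, zero_mul, zero_add] at e0 e1 e2 e3
    simp [wedgeB, wedgeE, cross3]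
    have hk : c 0 ≠ 0 ∨ c 2 ≠ 0 ∨ c 3 ≠ 0 := by
      by_contra! hcon
      apply hc
      ext i
      fin_cases i <;> simp [h1, hcon]
    rcases hk with hk | hk | hk <;> refine ⟨?_, ?_, ?_, ?_⟩ <;>
      refine (mul_eq_zero.1 ?_).resolve_left hk <;> grind
  have f0 : η.1 0 = -(c 0 / c 1) * ξ.1 0 - c 2 / c 1 * a.1 0 - c 3 / c 1 * b.1 0 := by
    field_simp; linarith
  have f1 : η.1 1 = -(c 0 / c 1) * ξ.1 1 - c 2 / c 1 * a.1 1 - c 3 / c 1 * b.1 1 := by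
    field_simp; linarith
  have f2 : η.1 2 = -(c 0 / c 1) * ξ.1 2 - c 2 / c 1 * a.1 2 - c 3 / c 1 * b.1 2 := by
    field_simp; linarith
  have f3 : η.2 = -(c 0 / c 1) * ξ.2 - c 2 / c 1 * a.2 - c 3 / c 1 * b.2 := by
    field_simp; linarith
  refine ⟨-(c 2 / c 1), -(c 3 / c 1), ?_, ?_⟩
  all_goals
    simp only [vec3_ext_iff]
    simp [wedgeB, wedgeE, cross3_zero, cross3_one, cross3_two, f0, f1, f2, f3]
    refine ⟨?_, ?_, ?_⟩ <;> ring

section Continuity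

variable {T : Type*} [TopologicalSpace T]

@[fun_prop]
theorem ContinuousAt.dot3' {f g : T → V3} {x : T} (hf : ContinuousAt f x)
    (hg : ContinuousAt g x) : ContinuousAt (fun y => dot3 (f y) (g y)) x := by
  have h : ∀ i, ContinuousAt (fun y => f y i * g y i) x := fun i =>
    (continuousAt_pi.1 hf i).mul (continuousAt_pi.1 hg i)
  simp only [dot3, Fin.sum_univ_three]
  exact ((h 0).add (h 1)).add (h 2)

@[fun_prop]
theorem ContinuousAt.cross3' {f g : T → V3} {x : T} (hf : ContinuousAt f x)
    (hg : ContinuousAt g x) : ContinuousAt (fun y => cross3 (f y) (g y)) x := by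
  have h : ∀ i, ContinuousAt (fun y => f y i) x := continuousAt_pi.1 hf
  have h' : ∀ i, ContinuousAt (fun y => g y i) x := continuousAt_pi.1 hg
  refine continuousAt_pi.2 fun i => ?_
  fin_cases i <;> simp only [Fin.zero_eta, Fin.mk_one, Fin.reduceFinMk, cross3_zero, cross3_one,
    cross3_two] <;>
  exact ((h _).mul (h' _)).sub ((h _).mul (h' _))

@[fun_prop]
theorem ContinuousAt.wedgeB' {f g : T → V3 × ℝ} {x : T} (hf : ContinuousAt f x)
    (hg : ContinuousAt g x) : ContinuousAt (fun y => wedgeB (f y) (g y)) x := by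
  unfold wedgeB
  fun_prop

@[fun_prop]
theorem ContinuousAt.wedgeE' {f g : T → V3 × ℝ} {x : T} (hf : ContinuousAt f x)
    (hg : ContinuousAt g x) : ContinuousAt (fun y => wedgeE (f y) (g y)) x := by
  unfold wedgeE
  fun_prop

@[fun_prop]
theorem ContinuousAt.contract' {f g : T → V3} {x : T} (X : V3 × ℝ) (hf : ContinuousAt f x)
    (hg : ContinuousAt g x) : ContinuousAt (fun y => contract X (f y) (g y)) x := by
  unfold contract
  fun_prop

@[fun_prop]
theorem ContinuousAt.formEval' {f g : T → V3} {x : T} (X Y : V3 × ℝ) (hf : ContinuousAt f x)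
    (hg : ContinuousAt g x) : ContinuousAt (fun y => formEval X Y (f y) (g y)) x := by
  unfold formEval
  fun_prop

end Continuity

theorem eq_wedge_contract (X Y : V3 × ℝ) {B E : V3} (h : dot3 B E = 0) {s t : ℝ}
    (hst : s * t * formEval X Y B E = 1) :
    B = wedgeB (s • contract X B E) (t • contract Y B E) ∧
    E = wedgeE (s • contract X B E) (t • contract Y B E) := by
  rw [wedgeB_smul, wedgeE_smul, (wedge_contract X Y h).1, (wedge_contract X Y h).2, smul_smul,
    smul_smul, hst, one_smul, one_smul]
  exact ⟨rfl, rfl⟩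

theorem exists_contract_eq {a b : V3 × ℝ} (h : ¬(wedgeB a b = 0 ∧ wedgeE a b = 0)) :
    ∃ X Y : V3 × ℝ, contract X (wedgeB a b) (wedgeE a b) = a ∧
      contract Y (wedgeB a b) (wedgeE a b) = b ∧
      formEval X Y (wedgeB a b) (wedgeE a b) = 1 := by
  set p := dot3 a.1 a.1 + a.2 * a.2 with hp
  set q := dot3 b.1 b.1 + b.2 * b.2 with hq
  set r := dot3 a.1 b.1 + a.2 * b.2 with hr
  have hg : p * q - r ^ 2 ≠ 0 := by
    intro hg
    apply h
    have : p * q - r ^ 2 = dot3 (wedgeB a b) (wedgeB a b) + dot3 (wedgeE a b) (wedgeE a b) := by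
      simp [hp, hq, hr, dot3, wedgeB, wedgeE, cross3, Fin.sum_univ_three]
      ring
    rw [hg] at this
    simp only [dot3, Fin.sum_univ_three] at this
    simp only [vec3_ext_iff, Pi.zero_apply]
    refine ⟨⟨?_, ?_, ?_⟩, ?_, ?_, ?_⟩ <;>
    nlinarith [mul_self_nonneg (wedgeB a b 0), mul_self_nonneg (wedgeB a b 1),
      mul_self_nonneg (wedgeB a b 2), mul_self_nonneg (wedgeE a b 0),
      mul_self_nonneg (wedgeE a b 1), mul_self_nonneg (wedgeE a b 2)]
  set X := (p * q - r ^ 2)⁻¹ • (r • a - p • b) with hX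
  set Y := (p * q - r ^ 2)⁻¹ • (q • a - r • b) with hY
  have hXa : dot3 X.1 a.1 + X.2 * a.2 = 0 := by
    have : dot3 X.1 a.1 + X.2 * a.2 = (p * q - r ^ 2)⁻¹ * (r * p - p * r) := by
      rw [hX]; simp [dot3, Fin.sum_univ_three, hp, hr]; ring
    rw [this]; ring
  have hXb : dot3 X.1 b.1 + X.2 * b.2 = -1 := by
    have : dot3 X.1 b.1 + X.2 * b.2 = (p * q - r ^ 2)⁻¹ * (r * r - p * q) := by
      rw [hX]; simp [dot3, Fin.sum_univ_three, hp, hr, hq]; ring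
    rw [this]; field_simp; ring
  have hYa : dot3 Y.1 a.1 + Y.2 * a.2 = 1 := by
    have : dot3 Y.1 a.1 + Y.2 * a.2 = (p * q - r ^ 2)⁻¹ * (q * p - r * r) := by
      rw [hY]; simp [dot3, Fin.sum_univ_three, hp, hr, hq]; ring
    rw [this]; field_simp
  have hYb : dot3 Y.1 b.1 + Y.2 * b.2 = 0 := by
    have : dot3 Y.1 b.1 + Y.2 * b.2 = (p * q - r ^ 2)⁻¹ * (q * r - r * q) := by
      rw [hY]; simp [dot3, Fin.sum_univ_three, hq, hr]; ring
    rw [this]; ring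
  have hcX : contract X (wedgeB a b) (wedgeE a b) = a := by
    rw [contract_wedge, hXa, hXb]; simp
  refine ⟨X, Y, hcX, by rw [contract_wedge, hYa, hYb]; simp, ?_⟩
  rw [formEval, hcX]
  simp only [dot3, Fin.sum_univ_three] at hYa ⊢
  linarith

theorem eventually_exists_wedge_of_ne_zero {a b : V3 × ℝ}
    (h : ¬(wedgeB a b = 0 ∧ wedgeE a b = 0)) {N : Set ((V3 × ℝ) × (V3 × ℝ))}
    (hN : N ∈ 𝓝 (a, b)) :
    ∀ᶠ p : V3 × V3 in 𝓝 (wedgeB a b, wedgeE a b), dot3 p.1 p.2 = 0 →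
      ∃ a' b' : V3 × ℝ, (a', b') ∈ N ∧ p.1 = wedgeB a' b' ∧ p.2 = wedgeE a' b' := by
  obtain ⟨X, Y, hX, hY, hXY⟩ := exists_contract_eq h
  have hc : ContinuousAt (fun p : V3 × V3 => formEval X Y p.1 p.2)
      (wedgeB a b, wedgeE a b) := by fun_prop
  have hne : ∀ᶠ p : V3 × V3 in 𝓝 (wedgeB a b, wedgeE a b), formEval X Y p.1 p.2 ≠ 0 :=
    hc.eventually_ne (by simp [hXY])
  have hF : ContinuousAt (fun p : V3 × V3 =>
      ((formEval X Y p.1 p.2)⁻¹ • contract X p.1 p.2, (1 : ℝ) • contract Y p.1 p.2))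
      (wedgeB a b, wedgeE a b) := by
    refine ContinuousAt.prodMk ((hc.inv₀ (by simp [hXY])).smul ?_) ?_ <;> fun_prop
  have hev := hF.eventually_mem (s := N) (by simpa [hX, hY, hXY] using hN)
  filter_upwards [hne, hev] with p hp hpN hdot
  have := eq_wedge_contract X Y (s := (formEval X Y p.1 p.2)⁻¹) (t := 1) hdot
    (by field_simp)
  exact ⟨_, _, hpN, this.1, this.2⟩

theorem norm_contract_le {X : V3 × ℝ} (hX : ‖X‖ ≤ 1) (p : V3 × V3) :
    ‖contract X p.1 p.2‖ ≤ 3 * ‖p‖ := by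
  have hX1 : ∀ i, |X.1 i| ≤ 1 := fun i =>
    (norm_le_pi_norm X.1 i).trans ((norm_fst_le X).trans hX)
  have hX2 : |X.2| ≤ 1 := (norm_snd_le X).trans hX
  have hB : ∀ i, |p.1 i| ≤ ‖p‖ := fun i => (norm_le_pi_norm p.1 i).trans (norm_fst_le p)
  have hE : ∀ i, |p.2 i| ≤ ‖p‖ := fun i => (norm_le_pi_norm p.2 i).trans (norm_snd_le p)
  have hm : ∀ x y : ℝ, |x| ≤ 1 → |y| ≤ ‖p‖ → |x * y| ≤ ‖p‖ := fun x y hx hy => by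
    rw [abs_mul]
    nlinarith [abs_nonneg x, abs_nonneg y]
  have h1 := fun i j => abs_le.1 (hm _ _ (hX1 i) (hB j))
  have h2 := fun i j => abs_le.1 (hm _ _ (hX1 i) (hE j))
  have h3 := fun j => abs_le.1 (hm _ _ hX2 (hE j))
  rw [Prod.norm_def, max_le_iff]
  constructor
  · rw [pi_norm_le_iff_of_nonneg (by positivity)]
    intro i
    rw [Real.norm_eq_abs, abs_le]
    simp only [contract, Pi.sub_apply, Pi.smul_apply, smul_eq_mul]
    fin_cases i <;> simp only [Fin.zero_eta, Fin.mk_one, Fin.reduceFinMk, cross3_zero, cross3_one,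
      cross3_two]
    · constructor <;> linarith [h1 2 1, h1 1 2, h3 0]
    · constructor <;> linarith [h1 2 0, h1 0 2, h3 1]
    · constructor <;> linarith [h1 0 1, h1 1 0, h3 2]
  · rw [Real.norm_eq_abs, abs_le]
    simp only [contract, dot3, Fin.sum_univ_three]
    constructor <;> linarith [h2 0 0, h2 1 1, h2 2 2]

theorem exists_formEval_eq_norm (p : V3 × V3) :
    ∃ X Y : V3 × ℝ, ‖X‖ ≤ 1 ∧ ‖Y‖ ≤ 1 ∧ |formEval X Y p.1 p.2| = ‖p‖ := by
  have hv : ∀ v : V3, ∃ i, ‖v‖ = |v i| := fun v => by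
    obtain ⟨i, hi⟩ := Finite.exists_max fun i => |v i|
    exact ⟨i, le_antisymm ((pi_norm_le_iff_of_nonneg (abs_nonneg _)).2 hi) (norm_le_pi_norm v i)⟩
  have hs : ∀ i : Fin 3, ‖((Pi.single i 1, 0) : V3 × ℝ)‖ ≤ 1 := fun i => by
    rw [Prod.norm_def, norm_zero, max_eq_left (norm_nonneg _),
      pi_norm_le_iff_of_nonneg zero_le_one]
    intro j
    by_cases hj : j = i
    · subst hj; simp
    · simp [hj]
  rcases le_total ‖p.1‖ ‖p.2‖ with h | h
  · obtain ⟨i, hi⟩ := hv p.2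
    refine ⟨(Pi.single i 1, 0), (0, 1), hs i, by simp [Prod.norm_def], ?_⟩
    rw [Prod.norm_def, max_eq_right h, hi]
    fin_cases i <;> simp [formEval, contract, dot3, Fin.sum_univ_three]
  · obtain ⟨i, hi⟩ := hv p.1
    refine ⟨(Pi.single (i + 1) 1, 0), (Pi.single (i + 2) 1, 0), hs _, hs _, ?_⟩
    rw [Prod.norm_def, max_eq_left h, hi]
    fin_cases i <;> simp [formEval, contract, dot3, cross3, Fin.sum_univ_three]

theorem eventually_exists_wedge_zero {N : Set ((V3 × ℝ) × (V3 × ℝ))} (hN : N ∈ 𝓝 0) :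
    ∀ᶠ p : V3 × V3 in 𝓝 0, dot3 p.1 p.2 = 0 →
      ∃ a b : V3 × ℝ, (a, b) ∈ N ∧ p.1 = wedgeB a b ∧ p.2 = wedgeE a b := by
  obtain ⟨ε, hε, hball⟩ := Metric.mem_nhds_iff.1 hN
  have hsmall : ∀ᶠ p : V3 × V3 in 𝓝 0, 3 * √‖p‖ < ε := by
    have : ContinuousAt (fun p : V3 × V3 => 3 * √‖p‖) 0 := by fun_prop
    exact this.eventually_lt continuousAt_const (by simpa using hε)
  filter_upwards [hsmall] with p hp hdot
  obtain ⟨X, Y, hX, hY, hXY⟩ := exists_formEval_eq_norm p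
  by_cases hp0 : p = 0
  · refine ⟨0, 0, mem_of_mem_nhds hN, ?_, ?_⟩
    · simp [hp0, vec3_ext_iff, wedgeB, cross3]
    · simp [hp0, wedgeE]
  have hm : 0 < ‖p‖ := norm_pos_iff.2 hp0
  have hsq : 0 < √‖p‖ := Real.sqrt_pos.2 hm
  have hss : √‖p‖ * √‖p‖ = ‖p‖ := Real.mul_self_sqrt hm.le
  have hf : formEval X Y p.1 p.2 ≠ 0 := by
    rw [← abs_pos, hXY]; exact hm
  have := eq_wedge_contract X Y (s := (√‖p‖)⁻¹) (t := √‖p‖ / formEval X Y p.1 p.2) hdot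
    (by field_simp)
  refine ⟨_, _, hball ?_, this.1, this.2⟩
  have hle : (√‖p‖)⁻¹ * (3 * ‖p‖) = 3 * √‖p‖ := by
    nth_rewrite 2 [← hss]
    field_simp
  have hle' : √‖p‖ / ‖p‖ * (3 * ‖p‖) = 3 * √‖p‖ := by field_simp
  rw [mem_ball_zero_iff, Prod.norm_def, max_lt_iff]
  constructor
  · refine lt_of_le_of_lt ?_ hp
    rw [norm_smul, ← hle, Real.norm_of_nonneg (by positivity)]
    gcongr
    exact norm_contract_le hX p
  · refine lt_of_le_of_lt ?_ hp
    rw [norm_smul, ← hle', norm_div, Real.norm_of_nonneg hsq.le, Real.norm_eq_abs, hXY]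
    gcongr
    exact norm_contract_le hY p

/-- The component of `u` orthogonal to `ζ_x`. -/
def adaptU (u : V3) (ζ : V3 × ℝ) : V3 := u - (dot3 ζ.1 u / dot3 ζ.1 ζ.1) • ζ.1

/-- The defect of the momentum equation for `(adaptU u ζ, S)` in the direction `ζ`. -/
def adaptDefect (u : V3) (S : Mat3) (ζ : V3 × ℝ) : V3 := -(ζ.2 • adaptU u ζ + S.mulVec ζ.1)

/-- A symmetric correction of `S` such that `(adaptU u ζ, adaptS u S ζ)` satisfies the momentum
equation in the direction `ζ`. -/
def adaptS (u : V3) (S : Mat3) (ζ : V3 × ℝ) : Mat3 := Matrix.of fun i j =>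
  S i j + (adaptDefect u S ζ i * ζ.1 j + ζ.1 i * adaptDefect u S ζ j) / dot3 ζ.1 ζ.1 -
    dot3 (adaptDefect u S ζ) ζ.1 / dot3 ζ.1 ζ.1 ^ 2 * (ζ.1 i * ζ.1 j)

theorem dot3_self_ne_zero_s11 {n : V3} (hn : n ≠ 0) : dot3 n n ≠ 0 := by
  have := sq_sum_ne_zero hn
  simpa [dot3, Fin.sum_univ_three, sq] using this

theorem continuousAt_adaptU (u : V3) {ξ : V3 × ℝ} (hξ : ξ.1 ≠ 0) :
    ContinuousAt (adaptU u) ξ := by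
  have hd := dot3_self_ne_zero_s11 hξ
  unfold adaptU
  have : ContinuousAt (fun ζ : V3 × ℝ => dot3 ζ.1 u / dot3 ζ.1 ζ.1) ξ :=
    ContinuousAt.div (by fun_prop) (by fun_prop) hd
  fun_prop

theorem continuousAt_adaptDefect (u : V3) (S : Mat3) {ξ : V3 × ℝ} (hξ : ξ.1 ≠ 0) :
    ContinuousAt (adaptDefect u S) ξ := by
  have h := continuousAt_adaptU u hξ
  have hS : ContinuousAt (fun ζ : V3 × ℝ => S.mulVec ζ.1) ξ :=
    (Continuous.matrix_mulVec continuous_const continuous_fst).continuousAt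
  unfold adaptDefect
  exact ((continuousAt_snd.smul h).add hS).neg

theorem continuousAt_adaptS (u : V3) (S : Mat3) {ξ : V3 × ℝ} (hξ : ξ.1 ≠ 0) :
    ContinuousAt (adaptS u S) ξ := by
  have hd := dot3_self_ne_zero_s11 hξ
  have hr := continuousAt_adaptDefect u S hξ
  have hri := continuousAt_pi.1 hr
  have hn : ∀ i, ContinuousAt (fun ζ : V3 × ℝ => ζ.1 i) ξ := fun i => by fun_prop
  have hdc : ContinuousAt (fun ζ : V3 × ℝ => dot3 ζ.1 ζ.1) ξ := by fun_prop
  refine continuousAt_pi.2 fun i => continuousAt_pi.2 fun j => ?_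
  exact (continuousAt_const.add ((((hri i).mul (hn j)).add ((hn i).mul (hri j))).div hdc hd)).sub
    (((hr.dot3' continuousAt_fst).div (hdc.pow 2) (pow_ne_zero 2 hd)).mul ((hn i).mul (hn j)))

theorem adaptU_eq {u : V3} {ξ : V3 × ℝ} (h : dot3 ξ.1 u = 0) : adaptU u ξ = u := by
  simp [adaptU, h]

theorem adaptS_eq {u : V3} {S : Mat3} {ξ : V3 × ℝ} (h : dot3 ξ.1 u = 0)
    (hS : ξ.2 • u + S.mulVec ξ.1 = 0) : adaptS u S ξ = S := by
  have : adaptDefect u S ξ = 0 := by rw [adaptDefect, adaptU_eq h, hS, neg_zero]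
  ext i j
  simp [adaptS, this, dot3]

theorem dot3_adaptU (u : V3) {ζ : V3 × ℝ} (hζ : ζ.1 ≠ 0) : dot3 ζ.1 (adaptU u ζ) = 0 := by
  have hd := dot3_self_ne_zero_s11 hζ
  have : dot3 ζ.1 (adaptU u ζ) =
      dot3 ζ.1 u - dot3 ζ.1 u / dot3 ζ.1 ζ.1 * dot3 ζ.1 ζ.1 := by
    simp only [adaptU]
    generalize dot3 ζ.1 u / dot3 ζ.1 ζ.1 = c
    simp [dot3, Fin.sum_univ_three]
    ring
  rw [this]
  field_simp
  ring

theorem adaptS_isSymm (u : V3) {S : Mat3} (hS : S.IsSymm) (ζ : V3 × ℝ) :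
    (adaptS u S ζ).IsSymm := by
  ext i j
  simp only [Matrix.transpose_apply, adaptS, Matrix.of_apply, hS.apply i j]
  ring

theorem adapt_momentum (u : V3) (S : Mat3) {ζ : V3 × ℝ} (hζ : ζ.1 ≠ 0) :
    ζ.2 • adaptU u ζ + (adaptS u S ζ).mulVec ζ.1 = 0 := by
  have hd := dot3_self_ne_zero_s11 hζ
  have key : (adaptS u S ζ).mulVec ζ.1 = S.mulVec ζ.1 + adaptDefect u S ζ := by
    ext i
    simp only [Matrix.mulVec, dotProduct, adaptS, Matrix.of_apply, Pi.add_apply]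
    generalize adaptDefect u S ζ = r
    have h1 : dot3 ζ.1 ζ.1 = ζ.1 0 * ζ.1 0 + ζ.1 1 * ζ.1 1 + ζ.1 2 * ζ.1 2 := by
      simp [dot3, Fin.sum_univ_three]
    have h2 : dot3 r ζ.1 = r 0 * ζ.1 0 + r 1 * ζ.1 1 + r 2 * ζ.1 2 := by
      simp [dot3, Fin.sum_univ_three]
    generalize dot3 ζ.1 ζ.1 = d at hd h1
    generalize dot3 r ζ.1 = e at h2
    simp only [Fin.sum_univ_three]
    field_simp
    grind
  rw [key, adaptDefect]
  abel

theorem polar_wedge_of_formAnn_left {a : V3 × ℝ} {B E : V3} (h : FormAnn a B E) (b : V3 × ℝ) :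
    polar (wedgeB a b) (wedgeE a b) B E = 0 := by
  rw [formAnn_iff] at h
  obtain ⟨h0, h1, h2, h3⟩ := h
  simp [polar, dot3, wedgeB, wedgeE, cross3, Fin.sum_univ_three]
  linear_combination b.2 * h0 - b.1 0 * h1 - b.1 1 * h2 - b.1 2 * h3

theorem polar_comm (B E B' E' : V3) : polar B E B' E' = polar B' E' B E := add_comm _ _

theorem polar_wedge_of_formAnn_right {b : V3 × ℝ} {B E : V3} (h : FormAnn b B E) (a : V3 × ℝ) :
    polar (wedgeB a b) (wedgeE a b) B E = 0 := by
  rw [formAnn_iff] at h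
  obtain ⟨h0, h1, h2, h3⟩ := h
  simp [polar, dot3, wedgeB, wedgeE, cross3, Fin.sum_univ_three]
  linear_combination -(a.2 * h0 - a.1 0 * h1 - a.1 1 * h2 - a.1 2 * h3)

theorem formAnn_wedge_rotate {a b c : V3 × ℝ} (h : FormAnn a (wedgeB b c) (wedgeE b c)) :
    FormAnn c (wedgeB a b) (wedgeE a b) := by
  rw [formAnn_iff] at h ⊢
  simp [wedgeB, wedgeE, cross3] at h ⊢
  obtain ⟨h0, h1, h2, h3⟩ := h
  refine ⟨?_, ?_, ?_, ?_⟩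
  · linear_combination h0
  · linear_combination h1
  · linear_combination h2
  · linear_combination h3

theorem formAnn_wedge_swap {a b c : V3 × ℝ} (h : FormAnn a (wedgeB b c) (wedgeE b c)) :
    FormAnn b (wedgeB a c) (wedgeE a c) := by
  rw [formAnn_iff] at h ⊢
  simp [wedgeB, wedgeE, cross3] at h ⊢
  obtain ⟨h0, h1, h2, h3⟩ := h
  refine ⟨?_, ?_, ?_, ?_⟩
  · linear_combination -h0
  · linear_combination -h1
  · linear_combination -h2
  · linear_combination -h3

theorem exists_transverse_wedge {ξ : V3 × ℝ} (hξ : ξ.1 ≠ 0) {B E B₀ E₀ : V3}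
    (h : FormAnn ξ B E) (h₀ : FormAnn ξ B₀ E₀) (hne : ¬(B = 0 ∧ E = 0)) :
    ∃ a b ζ : V3 × ℝ, ζ.1 ≠ 0 ∧ FormAnn ζ (wedgeB a b) (wedgeE a b) ∧
      polar (wedgeB a b) (wedgeE a b) B E = 0 ∧ polar (wedgeB a b) (wedgeE a b) B₀ E₀ = 0 ∧
      ¬FormAnn ξ (wedgeB a b) (wedgeE a b) ∧ ((B₀ = 0 ∧ E₀ = 0) ∨ ¬FormAnn ζ B₀ E₀) := by
  obtain ⟨η, hη, rfl, rfl⟩ := exists_wedge_of_formAnn hξ h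
  have hηω := formAnn_wedge_right ξ η
  by_cases hz : B₀ = 0 ∧ E₀ = 0
  · obtain ⟨q, hq, hqn, -⟩ := exists_not_formAnn hne hne
    obtain ⟨rfl, rfl⟩ := hz
    exact ⟨η, q, q, hq, formAnn_wedge_right _ _, polar_wedge_of_formAnn_left hηω _,
      by simp [polar, dot3], fun hc => hqn (formAnn_wedge_rotate hc), Or.inl ⟨rfl, rfl⟩⟩
  by_cases ha : FormAnn η B₀ E₀
  · obtain ⟨q, hq, hqn, hqn'⟩ := exists_not_formAnn hne hz
    exact ⟨η, q, q, hq, formAnn_wedge_right _ _, polar_wedge_of_formAnn_left hηω _,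
      polar_wedge_of_formAnn_left ha _, fun hc => hqn (formAnn_wedge_rotate hc), Or.inr hqn'⟩
  · obtain ⟨η₀, -, rfl, rfl⟩ := exists_wedge_of_formAnn hξ h₀
    exact ⟨η, η₀, η, hη, formAnn_wedge_left _ _, polar_wedge_of_formAnn_left hηω _,
      polar_wedge_of_formAnn_right (formAnn_wedge_right _ _) _,
      fun hc => ha (formAnn_wedge_swap hc), Or.inr ha⟩

theorem exists_eq_wedge {B E : V3} (h : dot3 B E = 0) :
    ∃ a b : V3 × ℝ, B = wedgeB a b ∧ E = wedgeE a b := by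
  by_cases h0 : (B, E) = 0
  · obtain ⟨rfl, rfl⟩ := Prod.mk.inj h0
    exact ⟨0, 0, by simp [vec3_ext_iff, wedgeB, cross3], by simp [wedgeE]⟩
  · obtain ⟨X, Y, -, -, hXY⟩ := exists_formEval_eq_norm (B, E)
    have hne : formEval X Y B E ≠ 0 := by
      rw [← abs_pos, hXY]; exact norm_pos_iff.2 h0
    exact ⟨_, _, eq_wedge_contract X Y (s := 1) (t := (formEval X Y B E)⁻¹) h (by field_simp)⟩

/-- The polarization of `B·E` on states. -/
def polarState (V W : MHDState) : ℝ := polar V.2.2.1 V.2.2.2 W.2.2.1 W.2.2.2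

theorem polarState_add_smul_left (V W Z : MHDState) (t : ℝ) :
    polarState (V + t • W) Z = polarState V Z + t * polarState W Z := by
  simp [polarState, polar, dot3, Fin.sum_univ_three]
  ring

theorem polarState_comm (V W : MHDState) : polarState V W = polarState W V := add_comm _ _

theorem dot3_add_smul (V W : MHDState) (t : ℝ) :
    dot3 (V + t • W).2.2.1 (V + t • W).2.2.2 =
      dot3 V.2.2.1 V.2.2.2 + t * polarState V W + t ^ 2 * dot3 W.2.2.1 W.2.2.2 := by
  simp [polarState, polar, dot3, Fin.sum_univ_three]
  ring

theorem add_smul_mem_mSet {V W : MHDState} (hV : V ∈ MSet) (hW : W ∈ MSet)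
    (h : polarState V W = 0) (t : ℝ) : V + t • W ∈ MSet := by
  refine ⟨hV.1.add (hW.1.smul t), ?_⟩
  rw [dot3_add_smul, hV.2, hW.2, h]
  ring

theorem polarState_eq_zero {V W : MHDState} (hV : V ∈ MSet) (hW : W ∈ MSet) {t : ℝ} (ht : t ≠ 0)
    (h : V + t • W ∈ MSet) : polarState V W = 0 := by
  have := h.2
  rw [dot3_add_smul, hV.2, hW.2] at this
  simpa [ht] using this

theorem annihilates_iff (ξ : V3 × ℝ) (V : MHDState) : Annihilates ξ.1 ξ.2 V ↔
    dot3 ξ.1 V.1 = 0 ∧ ξ.2 • V.1 + V.2.1.mulVec ξ.1 = 0 ∧ FormAnn ξ V.2.2.1 V.2.2.2 := by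
  unfold Annihilates FormAnn
  tauto

theorem mem_waveCone_iff (V : MHDState) : V ∈ WaveCone ↔ V.2.1.IsSymm ∧ ∃ ξ : V3 × ℝ, ξ.1 ≠ 0 ∧
    dot3 ξ.1 V.1 = 0 ∧ ξ.2 • V.1 + V.2.1.mulVec ξ.1 = 0 ∧ FormAnn ξ V.2.2.1 V.2.2.2 := by
  constructor
  · rintro ⟨hS, n, t, hn, h⟩
    exact ⟨hS, (n, t), hn, (annihilates_iff (n, t) V).1 h⟩
  · rintro ⟨hS, ξ, hn, h⟩
    exact ⟨hS, ξ.1, ξ.2, hn, (annihilates_iff ξ V).2 h⟩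

theorem mem_waveCone_of_wedge {u : V3} {S : Mat3} (hS : S.IsSymm) {ξ : V3 × ℝ} (hξ : ξ.1 ≠ 0)
    (hu : dot3 ξ.1 u = 0) (hm : ξ.2 • u + S.mulVec ξ.1 = 0) (η : V3 × ℝ) :
    ((u, S, wedgeB ξ η, wedgeE ξ η) : MHDState) ∈ WaveCone :=
  (mem_waveCone_iff _).2 ⟨hS, ξ, hξ, hu, hm, formAnn_wedge_left ξ η⟩

theorem waveCone_subset_mSet : WaveCone ⊆ MSet := by
  intro V hV
  obtain ⟨hS, ξ, hξ, -, -, h⟩ := (mem_waveCone_iff V).1 hV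
  obtain ⟨η, -, hB, hE⟩ := exists_wedge_of_formAnn hξ h
  refine ⟨hS, ?_⟩
  rw [hB, hE, dot3_wedge]

/-- The set `Y` contains every state at which a good segment with end-points in `Y` is centred. -/
def GoodStable (Y : Set MHDState) : Prop :=
  ∀ V₀ V : MHDState, ∀ lam : ℝ, GoodSegment V₀ V lam → V₀ + lam • V ∈ Y →
    V₀ - (1 - lam) • V ∈ Y → V₀ ∈ Y

/-- The states of `MSet` near `V` belong to `Y`. -/
def RelInt (Y : Set MHDState) (V : MHDState) : Prop := ∀ᶠ W in 𝓝 V, W ∈ MSet → W ∈ Y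

theorem goodSegment_of_zero {V₀ V : MHDState} {lam : ℝ} (h₀ : V₀ ∈ MSet) (hV : V ∈ WaveCone)
    (hl : 0 < lam) (hl' : lam < 1) (hz : V.2.2.1 = 0 ∧ V.2.2.2 = 0) : GoodSegment V₀ V lam := by
  obtain ⟨-, n, t, hn, h⟩ := id hV
  refine ⟨h₀, hV, hl, hl', fun s _ _ => add_smul_mem_mSet h₀ (waveCone_subset_mSet hV) ?_ s,
    n, t, hn, h, Or.inl hz⟩
  simp [polarState, polar, hz.1, hz.2, dot3]

theorem goodSegment_of_not_formAnn {V₀ V : MHDState} {lam : ℝ} (h₀ : V₀ ∈ MSet)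
    (hS : V.2.1.IsSymm) (hl : 0 < lam) (hl' : lam < 1) (hp : polarState V₀ V = 0) {ξ : V3 × ℝ}
    (hξ : ξ.1 ≠ 0) (h : Annihilates ξ.1 ξ.2 V) (hn : ¬FormAnn ξ V₀.2.2.1 V₀.2.2.2) :
    GoodSegment V₀ V lam := by
  have hV : V ∈ WaveCone := ⟨hS, ξ.1, ξ.2, hξ, h⟩
  exact ⟨h₀, hV, hl, hl', fun s _ _ => add_smul_mem_mSet h₀ (waveCone_subset_mSet hV) hp s,
    ξ.1, ξ.2, hξ, h, Or.inr (Or.inl (not_and_or.1 hn))⟩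

theorem goodSegment_form {V₀ : MHDState} (h₀ : V₀ ∈ MSet) {B E : V3} {ζ : V3 × ℝ} (hζ : ζ.1 ≠ 0)
    (h : FormAnn ζ B E) (hp : polar V₀.2.2.1 V₀.2.2.2 B E = 0)
    (hc : (V₀.2.2.1 = 0 ∧ V₀.2.2.2 = 0) ∨ ¬FormAnn ζ V₀.2.2.1 V₀.2.2.2) :
    GoodSegment V₀ (0, 0, B, E) (1 / 2) := by
  have hA : Annihilates ζ.1 ζ.2 (0, 0, B, E) := by
    rw [annihilates_iff]
    simp [dot3, h]
  rcases hc with hc | hc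
  · have hV : ((0, 0, B, E) : MHDState) ∈ WaveCone := ⟨by simp, ζ.1, ζ.2, hζ, hA⟩
    exact ⟨h₀, hV, by norm_num, by norm_num,
      fun s _ _ => add_smul_mem_mSet h₀ (waveCone_subset_mSet hV) hp s,
      ζ.1, ζ.2, hζ, hA, Or.inr (Or.inr (Or.inr ⟨rfl, rfl, hc⟩))⟩
  · exact goodSegment_of_not_formAnn h₀ (by simp) (by norm_num) (by norm_num) hp hζ hA hc

theorem GoodStable.mem_of_form {Y : Set MHDState} (hY : GoodStable Y) {V₀ : MHDState}
    (h₀ : V₀ ∈ MSet) {B E : V3} {ζ : V3 × ℝ} (hζ : ζ.1 ≠ 0)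
    (h : FormAnn ζ B E) (hp : polar V₀.2.2.1 V₀.2.2.2 B E = 0)
    (hc : (V₀.2.2.1 = 0 ∧ V₀.2.2.2 = 0) ∨ ¬FormAnn ζ V₀.2.2.1 V₀.2.2.2)
    (h1 : V₀ + (0, 0, B, E) ∈ Y) (h2 : V₀ - (0, 0, B, E) ∈ Y) : V₀ ∈ Y := by
  have hg := goodSegment_form h₀ hζ (B := (2 : ℝ) • B) (E := (2 : ℝ) • E)
    ((formAnn_smul 2 two_ne_zero).2 h) (by
      have : polar V₀.2.2.1 V₀.2.2.2 ((2 : ℝ) • B) ((2 : ℝ) • E) =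
          2 * polar V₀.2.2.1 V₀.2.2.2 B E := by
        simp [polar, dot3, Fin.sum_univ_three]
        ring
      rw [this, hp, mul_zero]) hc
  have e : (1 / 2 : ℝ) • ((0, 0, (2 : ℝ) • B, (2 : ℝ) • E) : MHDState) = (0, 0, B, E) := by
    simp [smul_smul]
  refine hY _ _ _ hg ?_ ?_
  · rwa [e]
  · rwa [show (1 - 1 / 2 : ℝ) = 1 / 2 by norm_num, e]

theorem GoodStable.mem_of_relInt {Y : Set MHDState} (hY : GoodStable Y) {V₀ V : MHDState}
    (h₀ : V₀ ∈ MSet) (hV : V ∈ WaveCone) (hp : polarState V₀ V = 0) {lam : ℝ} (hl : 0 < lam)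
    (hl' : lam < 1) (h1 : RelInt Y (V₀ + lam • V)) (h2 : RelInt Y (V₀ - (1 - lam) • V)) :
    V₀ ∈ Y := by
  have hVM := waveCone_subset_mSet hV
  have hm1 : V₀ + lam • V ∈ MSet := add_smul_mem_mSet h₀ hVM hp _
  have hsub : ∀ W : MHDState, W - (1 - lam) • V = W + (-(1 - lam)) • V := fun W => by
    rw [neg_smul, sub_eq_add_neg]
  have hm2 : V₀ - (1 - lam) • V ∈ MSet := by
    rw [hsub]
    exact add_smul_mem_mSet h₀ hVM hp _
  by_cases hz : V.2.2.1 = 0 ∧ V.2.2.2 = 0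
  · exact hY _ _ _ (goodSegment_of_zero h₀ hV hl hl' hz) (h1.self_of_nhds hm1)
      (h2.self_of_nhds hm2)
  obtain ⟨hS, ξ, hξ, hu, hm, hf⟩ := (mem_waveCone_iff V).1 hV
  have hA : Annihilates ξ.1 ξ.2 V := (annihilates_iff ξ V).2 ⟨hu, hm, hf⟩
  by_cases hn : FormAnn ξ V₀.2.2.1 V₀.2.2.2
  swap
  · exact hY _ _ _ (goodSegment_of_not_formAnn h₀ hS hl hl' hp hξ hA hn) (h1.self_of_nhds hm1)
      (h2.self_of_nhds hm2)
  obtain ⟨a, b, ζ, hζ, hζw, hpw, hpw₀, hξw, hc⟩ := exists_transverse_wedge hξ hf hn hz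
  set W : MHDState := (0, 0, wedgeB a b, wedgeE a b) with hW
  have hWM : W ∈ MSet := ⟨by simp [hW], dot3_wedge a b⟩
  have hpV : polarState V W = 0 := by rw [polarState_comm]; exact hpw
  have hpV₀ : polarState V₀ W = 0 := by rw [polarState_comm]; exact hpw₀
  have hcont : ∀ (P : MHDState) (c : ℝ),
      Tendsto (fun ε : ℝ => P + (c * ε) • W) (𝓝[≠] 0) (𝓝 P) := by
    intro P c
    have : Continuous fun ε : ℝ => P + (c * ε) • W := by fun_prop
    simpa using (this.tendsto 0).mono_left nhdsWithin_le_nhds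
  have key : ∀ c : ℝ, c ≠ 0 → ∀ᶠ ε : ℝ in 𝓝[≠] 0, V₀ + (c * ε) • W ∈ Y := by
    intro c hc
    filter_upwards [(hcont _ c).eventually h1, (hcont _ c).eventually h2, self_mem_nhdsWithin]
      with ε k1 k2 hε
    have hε' : c * ε ≠ 0 := mul_ne_zero hc hε
    have hM : V₀ + (c * ε) • W ∈ MSet := add_smul_mem_mSet h₀ hWM hpV₀ _
    have hpε : polarState (V₀ + (c * ε) • W) V = 0 := by
      rw [polarState_add_smul_left, hp, polarState_comm, hpV, mul_zero, add_zero]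
    have hg : GoodSegment (V₀ + (c * ε) • W) V lam := by
      refine goodSegment_of_not_formAnn hM hS hl hl' hpε hξ hA ?_
      intro hbad
      exact hξw ((formAnn_smul _ hε').1 ((formAnn_add_iff hn).1 hbad))
    refine hY _ _ _ hg ?_ ?_
    · rw [add_right_comm]
      refine k1 ?_
      rw [add_right_comm]
      exact add_smul_mem_mSet hM hVM hpε _
    · rw [add_sub_right_comm]
      refine k2 ?_
      rw [← add_sub_right_comm, hsub]
      exact add_smul_mem_mSet hM hVM hpε _
  obtain ⟨ε, k1, k2⟩ := ((key 1 one_ne_zero).and (key (-1) (by norm_num))).exists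
  have e : ((0, 0, ε • wedgeB a b, ε • wedgeE a b) : MHDState) = ε • W := by simp [hW]
  by_cases hε : ε = 0
  · simpa [hε] using k1
  refine hY.mem_of_form h₀ hζ ((formAnn_smul ε hε).2 hζw) ?_ hc ?_ ?_
  · have : polarState V₀ (ε • W) = 0 := by
      have := polarState_add_smul_left 0 W V₀ ε
      rw [zero_add, polarState_comm W, hpV₀, mul_zero, add_zero] at this
      rw [polarState_comm, this]
      simp [polarState, polar, dot3]
    exact this
  · rw [e]; simpa using k1
  · rw [e]; simpa [sub_eq_add_neg] using k2

theorem GoodStable.eventually_mem {T : Type*} [TopologicalSpace T] {Y : Set MHDState}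
    (hY : GoodStable Y) {F₀ F : T → MHDState} {x₀ : T} (hF₀ : ContinuousAt F₀ x₀)
    (hF : ContinuousAt F x₀) {lam : ℝ} (hl : 0 < lam) (hl' : lam < 1) {P Q : MHDState}
    (hP : F₀ x₀ + lam • F x₀ = P) (hQ : F₀ x₀ - (1 - lam) • F x₀ = Q)
    (h1 : RelInt Y P) (h2 : RelInt Y Q) :
    ∀ᶠ x in 𝓝 x₀, F₀ x ∈ MSet → F x ∈ WaveCone → polarState (F₀ x) (F x) = 0 → F₀ x ∈ Y := by
  subst hP hQ
  have c1 : ContinuousAt (fun x => F₀ x + lam • F x) x₀ := by fun_prop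
  have c2 : ContinuousAt (fun x => F₀ x - (1 - lam) • F x) x₀ := by fun_prop
  filter_upwards [c1.eventually h1.eventually_nhds, c2.eventually h2.eventually_nhds]
    with x k1 k2 hM hW hp
  exact hY.mem_of_relInt hM hW hp hl hl' k1 k2

theorem relInt_of_eventually_wedge {Y : Set MHDState} {V₀ : MHDState} {a b : V3 × ℝ}
    (hB : V₀.2.2.1 = wedgeB a b) (hE : V₀.2.2.2 = wedgeE a b)
    (hc : ¬(wedgeB a b = 0 ∧ wedgeE a b = 0) ∨ (a = 0 ∧ b = 0))
    (h : ∀ᶠ x : MHDState × ((V3 × ℝ) × (V3 × ℝ)) in 𝓝 (V₀, (a, b)), x.1 ∈ MSet →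
      x.1.2.2.1 = wedgeB x.2.1 x.2.2 → x.1.2.2.2 = wedgeE x.2.1 x.2.2 → x.1 ∈ Y) :
    RelInt Y V₀ := by
  rw [nhds_prod_eq, eventually_prod_iff] at h
  obtain ⟨p, hp, q, hq, h⟩ := h
  have hlift : ∀ᶠ ω : V3 × V3 in 𝓝 (V₀.2.2.1, V₀.2.2.2), dot3 ω.1 ω.2 = 0 →
      ∃ a' b' : V3 × ℝ, (a', b') ∈ {x | q x} ∧ ω.1 = wedgeB a' b' ∧ ω.2 = wedgeE a' b' := by
    rw [hB, hE]
    rcases hc with hc | ⟨rfl, rfl⟩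
    · exact eventually_exists_wedge_of_ne_zero hc hq
    · have hz : (wedgeB 0 0, wedgeE 0 0) = (0 : V3 × V3) := by
        ext i <;> simp [wedgeB, wedgeE, cross3]
        fin_cases i <;> rfl
      rw [hz]
      exact eventually_exists_wedge_zero hq
  have hcont : Continuous fun W : MHDState => (W.2.2.1, W.2.2.2) := by fun_prop
  filter_upwards [hp, hcont.continuousAt.eventually hlift] with W hW hWl hM
  obtain ⟨a', b', hab, e1, e2⟩ := hWl hM.2
  exact h hW hab hM e1 e2

theorem wedge_zero_left_s11 (a : V3 × ℝ) : wedgeB 0 a = 0 ∧ wedgeE 0 a = 0 := by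
  simp [wedgeB, wedgeE, cross3]

theorem wedge_add_wedge_swap (a b ξ : V3 × ℝ) (s : ℝ) :
    wedgeB a (b - s • ξ) = wedgeB a b + s • wedgeB ξ a ∧
      wedgeE a (b - s • ξ) = wedgeE a b + s • wedgeE ξ a := by
  simp only [vec3_ext_iff]
  simp [wedgeB, wedgeE, cross3]
  refine ⟨⟨?_, ?_, ?_⟩, ?_, ?_, ?_⟩ <;> ring

theorem formAnn_wedge_combination (a b : V3 × ℝ) (s t : ℝ) :
    FormAnn (s • a + t • b) (wedgeB a b) (wedgeE a b) :=
  (annSubmodule (wedgeB a b) (wedgeE a b)).add_mem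
    (Submodule.smul_mem _ s (formAnn_wedge_left a b))
    (Submodule.smul_mem _ t (formAnn_wedge_right a b))

section LaminateInterior

variable {Y : Set MHDState} {V₀ V : MHDState} {lam : ℝ}

theorem GoodStable.relInt_of_not_formAnn (hY : GoodStable Y) (h₀ : V₀ ∈ MSet)
    (hS : V.2.1.IsSymm) (hp : polarState V₀ V = 0) (hl : 0 < lam)
    (hl' : lam < 1) (h1 : RelInt Y (V₀ + lam • V)) (h2 : RelInt Y (V₀ - (1 - lam) • V))
    {ξ : V3 × ℝ} (hξ : ξ.1 ≠ 0) (hu : dot3 ξ.1 V.1 = 0) (hm : ξ.2 • V.1 + V.2.1.mulVec ξ.1 = 0)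
    (hf : FormAnn ξ V.2.2.1 V.2.2.2) (hn : ¬FormAnn ξ V₀.2.2.1 V₀.2.2.2) : RelInt Y V₀ := by
  obtain ⟨u, S, B, E⟩ := V
  obtain ⟨u₀, S₀, B₀, E₀⟩ := V₀
  simp only at hS hu hm hf hn
  obtain ⟨η, -, rfl, rfl⟩ := exists_wedge_of_formAnn hξ hf
  obtain ⟨a, b, rfl, rfl⟩ := exists_eq_wedge h₀.2
  obtain ⟨s, t, eB, eE⟩ := exists_wedge_contract ((polar_comm _ _ _ _).trans hp) hn
  refine relInt_of_eventually_wedge (a := a) (b := b) rfl rfl (Or.inl ?_) ?_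
  · rintro ⟨e1, e2⟩
    exact hn (by simp [e1, e2, formAnn_iff])
  filter_upwards [hY.eventually_mem (T := MHDState × ((V3 × ℝ) × (V3 × ℝ)))
    (x₀ := ((u₀, S₀, wedgeB a b, wedgeE a b), (a, b))) (F₀ := Prod.fst)
    (F := fun x => (u, S, wedgeB ξ (s • x.2.1 + t • x.2.2), wedgeE ξ (s • x.2.1 + t • x.2.2)))
    continuousAt_fst (by fun_prop) hl hl'
    (by simp only [← eB, ← eE]) (by simp only [← eB, ← eE]) h1 h2] with x hx hM e1 e2
  refine hx hM (mem_waveCone_of_wedge hS hξ hu hm _) ?_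
  rw [polarState_comm]
  unfold polarState
  rw [e1, e2]
  exact polar_wedge_of_formAnn_right (formAnn_wedge_combination _ _ s t) ξ

theorem GoodStable.relInt_of_formAnn (hY : GoodStable Y)
    (hS : V.2.1.IsSymm) (hl : 0 < lam)
    (hl' : lam < 1) (h1 : RelInt Y (V₀ + lam • V)) (h2 : RelInt Y (V₀ - (1 - lam) • V))
    {ξ : V3 × ℝ} (hξ : ξ.1 ≠ 0) (hu : dot3 ξ.1 V.1 = 0) (hm : ξ.2 • V.1 + V.2.1.mulVec ξ.1 = 0)
    (hf : FormAnn ξ V.2.2.1 V.2.2.2) (hn : FormAnn ξ V₀.2.2.1 V₀.2.2.2)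
    (hz : ¬(V₀.2.2.1 = 0 ∧ V₀.2.2.2 = 0)) : RelInt Y V₀ := by
  obtain ⟨u, S, B, E⟩ := V
  obtain ⟨u₀, S₀, B₀, E₀⟩ := V₀
  simp only at hS hu hm hf hn hz
  obtain ⟨η, -, rfl, rfl⟩ := exists_wedge_of_formAnn hξ hf
  obtain ⟨η₀, -, rfl, rfl⟩ := exists_wedge_of_formAnn hξ hn
  refine relInt_of_eventually_wedge (a := ξ) (b := η₀) rfl rfl (Or.inl hz) ?_
  set x₀ : MHDState × ((V3 × ℝ) × (V3 × ℝ)) := ((u₀, S₀, wedgeB ξ η₀, wedgeE ξ η₀), (ξ, η₀))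
  have c1 : ContinuousAt (fun x : MHDState × ((V3 × ℝ) × (V3 × ℝ)) => x.2.1) x₀ := by fun_prop
  have cU : ContinuousAt (fun x : MHDState × ((V3 × ℝ) × (V3 × ℝ)) => adaptU u x.2.1) x₀ :=
    ContinuousAt.comp (f := fun x : MHDState × ((V3 × ℝ) × (V3 × ℝ)) => x.2.1)
      (continuousAt_adaptU u hξ) c1
  have cS : ContinuousAt (fun x : MHDState × ((V3 × ℝ) × (V3 × ℝ)) => adaptS u S x.2.1) x₀ :=
    ContinuousAt.comp (f := fun x : MHDState × ((V3 × ℝ) × (V3 × ℝ)) => x.2.1)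
      (continuousAt_adaptS u S hξ) c1
  have eU := adaptU_eq hu
  have eS := adaptS_eq hu hm
  have hne : ∀ᶠ x : MHDState × ((V3 × ℝ) × (V3 × ℝ)) in 𝓝 x₀, x.2.1.1 ≠ 0 :=
    c1.fst.eventually_ne hξ
  filter_upwards [hne, hY.eventually_mem (x₀ := x₀) (F₀ := Prod.fst)
    (F := fun x => (adaptU u x.2.1, adaptS u S x.2.1, wedgeB x.2.1 η, wedgeE x.2.1 η))
    continuousAt_fst (by fun_prop) hl hl'
    (by simp only [x₀, eU, eS]) (by simp only [x₀, eU, eS]) h1 h2] with x hξx hx hM e1 e2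
  refine hx hM (mem_waveCone_of_wedge (adaptS_isSymm u hS _) hξx (dot3_adaptU u hξx)
    (adapt_momentum u S hξx) _) ?_
  rw [polarState_comm]
  unfold polarState
  rw [e1, e2]
  exact polar_wedge_of_formAnn_left (formAnn_wedge_left _ _) η

theorem GoodStable.relInt_of_center_zero (hY : GoodStable Y) (hV : V ∈ WaveCone) (hl : 0 < lam)
    (hl' : lam < 1) (h1 : RelInt Y (V₀ + lam • V)) (h2 : RelInt Y (V₀ - (1 - lam) • V))
    (hz : V₀.2.2.1 = 0 ∧ V₀.2.2.2 = 0) : RelInt Y V₀ := by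
  obtain ⟨hS, ξ, hξ, hu, hm, hf⟩ := (mem_waveCone_iff V).1 hV
  obtain ⟨u, S, B, E⟩ := V
  obtain ⟨u₀, S₀, B₀, E₀⟩ := V₀
  simp only at hS hu hm hf hz
  obtain ⟨rfl, rfl⟩ := hz
  obtain ⟨η, -, rfl, rfl⟩ := exists_wedge_of_formAnn hξ hf
  refine relInt_of_eventually_wedge (a := 0) (b := 0) (wedge_zero_left_s11 0).1.symm
    (wedge_zero_left_s11 0).2.symm (Or.inr ⟨rfl, rfl⟩) ?_
  set x₀ : MHDState × ((V3 × ℝ) × (V3 × ℝ)) := ((u₀, S₀, 0, 0), (0, 0))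
  have eU := adaptU_eq hu
  have eS := adaptS_eq hu hm
  have family : ∀ s : ℝ, (s = 1 ∨ s = -1) →
      ∀ᶠ x : MHDState × ((V3 × ℝ) × (V3 × ℝ)) in 𝓝 x₀, x.1 ∈ MSet →
        (x.1.1, x.1.2.1, wedgeB x.2.1 (x.2.2 - s • ξ), wedgeE x.2.1 (x.2.2 - s • ξ)) ∈ Y := by
    intro s hs
    have c1 : ContinuousAt (fun x : MHDState × ((V3 × ℝ) × (V3 × ℝ)) => ξ - s • x.2.2) x₀ := by
      fun_prop
    have hx₀ : ξ - s • x₀.2.2 = ξ := by simp [x₀]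
    have cU : ContinuousAt (fun x : MHDState × ((V3 × ℝ) × (V3 × ℝ)) =>
        adaptU u (ξ - s • x.2.2)) x₀ :=
      ContinuousAt.comp (g := adaptU u)
        (f := fun x : MHDState × ((V3 × ℝ) × (V3 × ℝ)) => ξ - s • x.2.2)
        (by rw [hx₀]; exact continuousAt_adaptU u hξ) c1
    have cS : ContinuousAt (fun x : MHDState × ((V3 × ℝ) × (V3 × ℝ)) =>
        adaptS u S (ξ - s • x.2.2)) x₀ :=
      ContinuousAt.comp (g := adaptS u S)
        (f := fun x : MHDState × ((V3 × ℝ) × (V3 × ℝ)) => ξ - s • x.2.2)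
        (by rw [hx₀]; exact continuousAt_adaptS u S hξ) c1
    have hne : ∀ᶠ x : MHDState × ((V3 × ℝ) × (V3 × ℝ)) in 𝓝 x₀, (ξ - s • x.2.2).1 ≠ 0 :=
      c1.fst.eventually_ne (by rwa [hx₀])
    have e₀ : x₀.2.1 = 0 := rfl
    have e₁ : x₀.1 = (u₀, S₀, 0, 0) := rfl
    filter_upwards [hne, hY.eventually_mem (x₀ := x₀)
      (F₀ := fun x => (x.1.1, x.1.2.1, wedgeB x.2.1 (x.2.2 - s • ξ), wedgeE x.2.1 (x.2.2 - s • ξ)))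
      (F := fun x => (adaptU u (ξ - s • x.2.2), adaptS u S (ξ - s • x.2.2),
        wedgeB (ξ - s • x.2.2) η, wedgeE (ξ - s • x.2.2) η))
      (by fun_prop) (by fun_prop) hl hl'
      (by simp only [hx₀, eU, eS, e₀, e₁, (wedge_zero_left_s11 _).1, (wedge_zero_left_s11 _).2])
      (by simp only [hx₀, eU, eS, e₀, e₁, (wedge_zero_left_s11 _).1, (wedge_zero_left_s11 _).2]) h1 h2]
      with x hξx hx hM
    refine hx ⟨hM.1, dot3_wedge _ _⟩ (mem_waveCone_of_wedge (adaptS_isSymm u hS _) hξx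
      (dot3_adaptU u hξx) (adapt_momentum u S hξx) _) ?_
    rw [polarState_comm]
    refine polar_wedge_of_formAnn_left ?_ η
    have hs2 : ξ - s • x.2.2 = (0 : ℝ) • x.2.1 + (-s) • (x.2.2 - s • ξ) := by
      have : s * s = 1 := by rcases hs with rfl | rfl <;> norm_num
      rw [smul_sub, smul_smul, neg_mul, this]
      module
    rw [hs2]
    exact formAnn_wedge_combination _ _ _ _
  filter_upwards [family 1 (Or.inl rfl), family (-1) (Or.inr rfl),
    hY.eventually_mem (x₀ := x₀) (F₀ := Prod.fst)
    (F := fun _ => (u, S, wedgeB ξ η, wedgeE ξ η)) continuousAt_fst continuousAt_const hl hl'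
    rfl rfl h1 h2] with x f1 f2 hx hM e1 e2
  obtain ⟨⟨uW, SW, BW, EW⟩, a, b⟩ := x
  simp only at f1 f2 hx hM e1 e2
  subst e1 e2
  by_cases hξW : FormAnn ξ (wedgeB a b) (wedgeE a b)
  · refine hx hM hV ?_
    rw [polarState_comm]
    exact polar_wedge_of_formAnn_left hξW η
  · refine hY.mem_of_form hM hξ (formAnn_wedge_left ξ a) ?_ (Or.inr hξW) ?_ ?_
    · rw [polar_comm]
      exact polar_wedge_of_formAnn_right (formAnn_wedge_left a b) ξ
    · have := f1 hM
      rw [(wedge_add_wedge_swap a b ξ 1).1, (wedge_add_wedge_swap a b ξ 1).2] at this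
      simpa using this
    · have := f2 hM
      rw [(wedge_add_wedge_swap a b ξ (-1)).1, (wedge_add_wedge_swap a b ξ (-1)).2] at this
      simpa [sub_eq_add_neg] using this

theorem GoodStable.relInt (hY : GoodStable Y) (h₀ : V₀ ∈ MSet) (hV : V ∈ WaveCone)
    (hp : polarState V₀ V = 0) (hl : 0 < lam) (hl' : lam < 1) (h1 : RelInt Y (V₀ + lam • V))
    (h2 : RelInt Y (V₀ - (1 - lam) • V)) : RelInt Y V₀ := by
  by_cases hz : V₀.2.2.1 = 0 ∧ V₀.2.2.2 = 0
  · exact hY.relInt_of_center_zero hV hl hl' h1 h2 hz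
  obtain ⟨hS, ξ, hξ, hu, hm, hf⟩ := (mem_waveCone_iff V).1 hV
  by_cases hn : FormAnn ξ V₀.2.2.1 V₀.2.2.2
  · exact hY.relInt_of_formAnn hS hl hl' h1 h2 hξ hu hm hf hn hz
  · exact hY.relInt_of_not_formAnn h₀ hS hp hl hl' h1 h2 hξ hu hm hf hn

end LaminateInterior

theorem monotone_lamHullG (Y : Set MHDState) : Monotone (lamHullG Y) :=
  monotone_nat_of_le_succ fun _ => Set.subset_union_left

theorem goodStable_lcHullG (Y : Set MHDState) : GoodStable (lcHullG Y) := by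
  intro V₀ V lam hg h1 h2
  obtain ⟨i, hi⟩ := Set.mem_iUnion.1 h1
  obtain ⟨j, hj⟩ := Set.mem_iUnion.1 h2
  exact Set.mem_iUnion.2 ⟨max i j + 1, Or.inr ⟨lam, V, hg,
    monotone_lamHullG Y (le_max_left i j) hi, monotone_lamHullG Y (le_max_right i j) hj⟩⟩

theorem subset_lcHullG (Y : Set MHDState) : Y ⊆ lcHullG Y :=
  fun _ hV => Set.mem_iUnion.2 ⟨0, hV⟩

theorem RelOpen.relInt {U : Set MHDState} (h : RelOpen U) {V : MHDState} (hV : V ∈ U) :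
    RelInt U V := by
  obtain ⟨δ, hδ, hδU⟩ := h V hV
  have hc : Continuous fun W : MHDState => stateNorm (W - V) := by
    unfold stateNorm
    have hS : ∀ i j, Continuous fun W : MHDState => (W - V).2.1 i j := fun i j =>
      ((continuous_snd.fst).sub continuous_const).matrix_elem i j
    fun_prop
  have h0 : stateNorm (V - V) < δ := by simpa [stateNorm] using hδ
  filter_upwards [hc.continuousAt.eventually_lt_const h0] with W hW hM
  exact hδU W hM hW

theorem lamHullG_subset_lamHull (Y : Set MHDState) (k : ℕ) : lamHullG Y k ⊆ lamHull Y k := by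
  induction k with
  | zero => exact subset_rfl
  | succ k ih =>
    rintro V₀ (h | ⟨lam, V, ⟨-, hV, hl, hl', -⟩, h1, h2⟩)
    · exact Or.inl (ih h)
    · refine Or.inr ⟨1 - lam, _, _, by linarith, by linarith, ih h1, ih h2, ?_, ?_⟩
      · have : V₀ + lam • V - (V₀ - (1 - lam) • V) = V := by module
        rwa [this]
      · module

theorem mem_mSet_and_relInt_of_mem_lamHull {U : Set MHDState} (hU : U ⊆ MSet) (hopen : RelOpen U)
    (N : ℕ) : ∀ V ∈ lamHull U N, V ∈ MSet ∧ RelInt (lcHullG U) V := by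
  induction N with
  | zero =>
    intro V hV
    exact ⟨hU hV, (hopen.relInt hV).mono fun W hW hM => subset_lcHullG U (hW hM)⟩
  | succ N ih =>
    rintro Z (h | ⟨lam, V, W, hl, hl', hV, hW, hD, rfl⟩)
    · exact ih Z h
    obtain ⟨hVM, hVY⟩ := ih V hV
    obtain ⟨hWM, hWY⟩ := ih W hW
    rcases hl.eq_or_lt with rfl | hl
    · simpa using ih W hW
    rcases hl'.eq_or_lt with rfl | hl'
    · simpa using ih V hV
    have hDM := waveCone_subset_mSet hD
    have hp : polarState W (V - W) = 0 :=
      polarState_eq_zero hWM hDM one_ne_zero (by simpa using hVM)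
    have hZ : lam • V + (1 - lam) • W = W + lam • (V - W) := by module
    have hDD : polarState (V - W) (V - W) = 0 := by
      have := hDM.2
      rw [polarState, polar, this, add_zero]
    have hpZ : polarState (W + lam • (V - W)) (V - W) = 0 := by
      rw [polarState_add_smul_left, hp, hDD, mul_zero, add_zero]
    have hZM : W + lam • (V - W) ∈ MSet := add_smul_mem_mSet hWM hDM hp lam
    rw [hZ]
    refine ⟨hZM, (goodStable_lcHullG U).relInt (lam := 1 - lam) hZM hD hpZ (by linarith)
      (by linarith) ?_ ?_⟩
    · have : W + lam • (V - W) + (1 - lam) • (V - W) = V := by module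
      rwa [this]
    · have : W + lam • (V - W) - (1 - (1 - lam)) • (V - W) = W := by module
      rwa [this]

/-- If 𝒰 ⊆ ℳ is bounded and relatively open in ℳ, then 𝒰^{lc,Λ} = 𝒰^{lc,Λ_g}. -/
theorem stmt11 (U : Set MHDState) (hU : U ⊆ MSet)
    (hbdd : ∃ R : ℝ, ∀ V ∈ U, stateNorm V ≤ R) (hopen : RelOpen U) :
    lcHull U = lcHullG U := by
  refine Set.Subset.antisymm (Set.iUnion_subset fun N V hV => ?_)
    (Set.iUnion_mono (lamHullG_subset_lamHull U))
  obtain ⟨hM, hY⟩ := mem_mSet_and_relInt_of_mem_lamHull hU hopen N V hV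
  exact hY.self_of_nhds hM
end
end

section
/- Let 0 < λ < 1 and ε > 0. Then there exists an infinitely differentiable function h : ℝ → ℝ such that: (i) its second derivative h'' is 1-periodic; (ii) −(1−λ) ≤ h''(s) ≤ λ for all s ∈ ℝ; (iii) ∫₀¹ h''(s) ds = 0; (iv) the Lebesgue measure of {s ∈ [0,1] : h''(s) = λ} is at least (1−ε)(1−λ); (v) the Lebesgue measure of {s ∈ [0,1] : h''(s) = −(1−λ)} is at least (1−ε)λ. -/
open MeasureTheory

/-- A smooth function on the line has a smooth primitive. -/
theorem exists_contDiff_deriv_eq {g : ℝ → ℝ} (hg : ContDiff ℝ (⊤ : ℕ∞) g) :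
    ∃ h : ℝ → ℝ, ContDiff ℝ (⊤ : ℕ∞) h ∧ deriv h = g := by
  have hd : ∀ x, HasDerivAt (fun x => ∫ t in (0 : ℝ)..x, g t) (g x) x := fun x =>
    hg.continuous.integral_hasStrictDerivAt 0 x |>.hasDerivAt
  have he : deriv (fun x => ∫ t in (0 : ℝ)..x, g t) = g := funext fun x => (hd x).deriv
  exact ⟨_, contDiff_infty_iff_deriv.2 ⟨fun x => (hd x).differentiableAt, by rwa [he]⟩, he⟩

/-- A smooth function supported in `[0, b]` with `b < 1` has a smooth periodization. -/
theorem contDiff_comp_fract {f : ℝ → ℝ} {n : WithTop ℕ∞} {b : ℝ} (hf : ContDiff ℝ n f)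
    (hb : b < 1) (h0 : ∀ x ≤ 0, f x = 0) (h1 : ∀ x, b ≤ x → f x = 0) :
    ContDiff ℝ n fun s => f (Int.fract s) := by
  rw [contDiff_iff_contDiffAt]
  intro s
  have hc : ContDiff ℝ n fun x => f (x - ⌊s⌋) := hf.comp (contDiff_id.sub contDiff_const)
  refine hc.contDiffAt.congr_of_eventuallyEq ?_
  have hl : max b 0 + ⌊s⌋ - 1 < s := by
    have := Int.floor_le s
    have : max b 0 < 1 := max_lt hb one_pos
    linarith
  filter_upwards [Ioo_mem_nhds hl (Int.lt_floor_add_one s)] with x hx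
  obtain ⟨hx1, hx2⟩ := hx
  have hb0 := le_max_left b 0
  have h00 := le_max_right b 0
  rcases le_or_gt (⌊s⌋ : ℝ) x with h | h
  · have : ⌊x⌋ = ⌊s⌋ := Int.floor_eq_iff.2 ⟨h, hx2⟩
    rw [Int.fract, this]
  · have : ⌊x⌋ = ⌊s⌋ - 1 := by
      refine Int.floor_eq_iff.2 ⟨?_, ?_⟩ <;> push_cast <;> linarith
    rw [Int.fract, this, h0 (x - ⌊s⌋) (by linarith), h1]
    push_cast
    linarith

/-- The difference of a smooth transition of width `δ` and its translate by `l`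
has integral `l` over the unit interval. -/
theorem integral_smoothTransition_sub_translate {l δ : ℝ} (hδ : 0 < δ) (hl : 0 ≤ l)
    (hlδ : l + δ ≤ 1) :
    ∫ s in (0 : ℝ)..1, (Real.smoothTransition (s / δ) - Real.smoothTransition ((s - l) / δ))
      = l := by
  have hc : Continuous fun s : ℝ => Real.smoothTransition (s / δ) :=
    Real.smoothTransition.continuous.comp (continuous_id.div_const δ)
  have hi : ∀ a b, IntervalIntegrable (fun s : ℝ => Real.smoothTransition (s / δ)) volume a b :=
    hc.intervalIntegrable
  have hc' : Continuous fun s : ℝ => Real.smoothTransition ((s - l) / δ) :=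
    hc.comp (continuous_id.sub continuous_const)
  rw [intervalIntegral.integral_sub (hi 0 1) (hc'.intervalIntegrable 0 1),
    intervalIntegral.integral_comp_sub_right (fun s => Real.smoothTransition (s / δ)) l,
    ← intervalIntegral.integral_add_adjacent_intervals (hi 0 (1 - l)) (hi (1 - l) 1),
    ← intervalIntegral.integral_add_adjacent_intervals (hi (0 - l) 0) (hi 0 (1 - l))]
  have e1 : ∫ s in (1 - l)..1, Real.smoothTransition (s / δ) = ∫ s in (1 - l)..1, (1 : ℝ) := by
    refine intervalIntegral.integral_congr fun s hs => ?_
    rw [Set.uIcc_of_le (by linarith)] at hs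
    exact Real.smoothTransition.one_of_one_le ((one_le_div hδ).2 (by linarith [hs.1]))
  have e2 : ∫ s in (0 - l)..0, Real.smoothTransition (s / δ) = ∫ s in (0 - l)..0, (0 : ℝ) := by
    refine intervalIntegral.integral_congr fun s hs => ?_
    rw [Set.uIcc_of_le (by linarith)] at hs
    exact Real.smoothTransition.zero_of_nonpos (div_nonpos_of_nonpos_of_nonneg hs.2 hδ.le)
  rw [e1, e2]
  simp

/-- There exists a smooth h : ℝ → ℝ whose second derivative is 1-periodic, takes
values in [−(1−λ), λ], has zero mean over [0,1], equals λ on a subset of [0,1] of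
measure ≥ (1−ε)(1−λ) and equals −(1−λ) on a subset of measure ≥ (1−ε)λ. -/
theorem stmt12 (lam ε : ℝ) (hlam0 : 0 < lam) (hlam1 : lam < 1) (hε : 0 < ε) :
    ∃ h : ℝ → ℝ, ContDiff ℝ (⊤ : ℕ∞) h ∧
      Function.Periodic (deriv (deriv h)) 1 ∧
      (∀ s : ℝ, -(1 - lam) ≤ deriv (deriv h) s ∧ deriv (deriv h) s ≤ lam) ∧
      (∫ s in (0 : ℝ)..1, deriv (deriv h) s) = 0 ∧
      ENNReal.ofReal ((1 - ε) * (1 - lam)) ≤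
        volume {s : ℝ | s ∈ Set.Icc (0 : ℝ) 1 ∧ deriv (deriv h) s = lam} ∧
      ENNReal.ofReal ((1 - ε) * lam) ≤
        volume {s : ℝ | s ∈ Set.Icc (0 : ℝ) 1 ∧ deriv (deriv h) s = -(1 - lam)} := by
  obtain ⟨δ, hδ, hδ1, hδ2, hδ3⟩ : ∃ δ : ℝ, 0 < δ ∧ δ < 1 - lam ∧ δ ≤ ε * lam ∧
      δ ≤ ε * (1 - lam) := by
    have h1 : 0 < 1 - lam := by linarith
    refine ⟨min ((1 - lam) / 2) (min (ε * lam) (ε * (1 - lam))), by positivity, ?_, ?_, ?_⟩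
    · exact (min_le_left _ _).trans_lt (by linarith)
    · exact (min_le_right _ _).trans (min_le_left _ _)
    · exact (min_le_right _ _).trans (min_le_right _ _)
  set f : ℝ → ℝ := fun x =>
    Real.smoothTransition (x / δ) - Real.smoothTransition ((x - lam) / δ) with hf
  have hfc : ContDiff ℝ (⊤ : ℕ∞) f :=
    (Real.smoothTransition.contDiff.comp (contDiff_id.div_const δ)).sub
      (Real.smoothTransition.contDiff.comp ((contDiff_id.sub contDiff_const).div_const δ))
  have hzero : ∀ x ≤ 0, Real.smoothTransition (x / δ) = 0 := fun x hx =>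
    Real.smoothTransition.zero_of_nonpos (div_nonpos_of_nonpos_of_nonneg hx hδ.le)
  have hone : ∀ x, δ ≤ x → Real.smoothTransition (x / δ) = 1 := fun x hx =>
    Real.smoothTransition.one_of_one_le ((one_le_div hδ).2 hx)
  have hf0 : ∀ x ≤ 0, f x = 0 := fun x hx => by
    simp only [hf]
    rw [hzero x hx, hzero (x - lam) (by linarith), sub_zero]
  have hf1 : ∀ x, lam + δ ≤ x → f x = 0 := fun x hx => by
    simp only [hf]
    rw [hone x (by linarith), hone (x - lam) (by linarith), sub_self]
  have hfplateau : ∀ x, δ ≤ x → x ≤ lam → f x = 1 := fun x hx hx' => by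
    simp only [hf]
    rw [hone x hx, hzero (x - lam) (by linarith), sub_zero]
  have hfnonneg : ∀ x, 0 ≤ f x := fun x =>
    sub_nonneg.2 (Real.smoothTransition.monotone
      (div_le_div_of_nonneg_right (by linarith) hδ.le))
  have hfle : ∀ x, f x ≤ 1 := fun x => by
    have := Real.smoothTransition.le_one (x / δ)
    have := Real.smoothTransition.nonneg ((x - lam) / δ)
    simp only [hf]
    linarith
  have hfract : ∀ s ∈ Set.Ico (0 : ℝ) 1, Int.fract s = s := fun s hs =>
    Int.fract_eq_self.2 hs
  have hgc : ContDiff ℝ (⊤ : ℕ∞) fun s => lam - f (Int.fract s) :=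
    contDiff_const.sub (contDiff_comp_fract hfc (by linarith) hf0 hf1)
  obtain ⟨k, hk, hkd⟩ := exists_contDiff_deriv_eq hgc
  obtain ⟨h, hh, hhd⟩ := exists_contDiff_deriv_eq hk
  refine ⟨h, hh, ?_⟩
  rw [hhd, hkd]
  refine ⟨fun s => by simp only [Int.fract_add_one],
    fun s => ⟨by linarith [hfle (Int.fract s)], by linarith [hfnonneg (Int.fract s)]⟩, ?_, ?_, ?_⟩
  · have e : ∫ s in (0 : ℝ)..1, (lam - f (Int.fract s)) = ∫ s in (0 : ℝ)..1, (lam - f s) := by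
      refine intervalIntegral.integral_congr fun s hs => ?_
      rw [Set.uIcc_of_le zero_le_one] at hs
      rcases hs.2.lt_or_eq with h1 | rfl
      · simp only [hfract s ⟨hs.1, h1⟩]
      · simp only [Int.fract_one, hf0 0 le_rfl, hf1 1 (by linarith)]
    rw [e, intervalIntegral.integral_sub (by simp) (hfc.continuous.intervalIntegrable 0 1),
      integral_smoothTransition_sub_translate hδ hlam0.le (by linarith)]
    simp
  · calc ENNReal.ofReal ((1 - ε) * (1 - lam)) ≤ ENNReal.ofReal (1 - (lam + δ)) :=
          ENNReal.ofReal_le_ofReal (by linarith)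
      _ = volume (Set.Ico (lam + δ) 1) := Real.volume_Ico.symm
      _ ≤ _ := measure_mono fun s hs => by
          have h0 : 0 ≤ s := by linarith [hs.1]
          refine ⟨⟨h0, hs.2.le⟩, ?_⟩
          simp only [hfract s ⟨h0, hs.2⟩, hf1 s hs.1, sub_zero]
  · calc ENNReal.ofReal ((1 - ε) * lam) ≤ ENNReal.ofReal (lam - δ) :=
          ENNReal.ofReal_le_ofReal (by linarith)
      _ = volume (Set.Icc δ lam) := Real.volume_Icc.symm
      _ ≤ _ := measure_mono fun s hs => by
          have h0 : 0 ≤ s := by linarith [hs.1]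
          have h1 : s < 1 := hs.2.trans_lt hlam1
          refine ⟨⟨h0, h1.le⟩, ?_⟩
          simp only [hfract s ⟨h0, h1⟩, hfplateau s hs.1 hs.2]
          ring
end
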